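/- arXiv:1709.10195 — 2 statements merged into one kernel-verified Lean document; each statement's English description precedes it below -/
import Mathlib

section
/- For every lattice word u and every n ≥ 1, the n-th 01-rigging of T(u) equals the n-th 01-rigging of u shifted up uniformly by n: ρ_01(Φ_01^{n-1}(T(u))) = σ^n(ρ_01(Φ_01^{n-1}(u))). In other words, the box-ball time evolution acts linearly on riggings. -/
/-- A state of the box-ball system: a semi-infinite `{0,1}`-sequence starting
with `0` and containing finitely many `1`s. -/
def IsState (u : ℕ → ℕ) : Prop :=
  u 0 = 0 ∧ (∀ j, u j ≤ 1) ∧ {j | u j = 1}.Finite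

/-- The set of descent positions: `u j > u (j+1)`. -/
def descSet (u : ℕ → ℕ) : Set ℕ := {j | u (j + 1) < u j}

/-- The set of ascent positions: `u j < u (j+1)`. -/
def ascSet (u : ℕ → ℕ) : Set ℕ := {j | u j < u (j + 1)}

/-- The descent number. -/
noncomputable def desN (u : ℕ → ℕ) : ℕ := (descSet u).ncard

/-- The ascent number. -/
noncomputable def ascN (u : ℕ → ℕ) : ℕ := (ascSet u).ncard

/-- The major index: sum of descent positions. -/
noncomputable def maj (u : ℕ → ℕ) : ℕ := ∑ᶠ j ∈ descSet u, j

/-- The comajor index: sum of ascent positions. -/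
noncomputable def comaj (u : ℕ → ℕ) : ℕ := ∑ᶠ j ∈ ascSet u, j

/-- The number of balls (`1`s) in a state. -/
noncomputable def numBalls (u : ℕ → ℕ) : ℕ := {j | u j = 1}.ncard

/-- The forward shift `Λ`. -/
def shift (u : ℕ → ℕ) : ℕ → ℕ := fun n => if n = 0 then 0 else u (n - 1)

/-- Position `j` is removed by the 10-elimination: it is a descent (the `1`)
or the successor of a descent (the `0`). -/
def removed10 (u : ℕ → ℕ) (j : ℕ) : Prop :=
  u (j + 1) < u j ∨ (1 ≤ j ∧ u j < u (j - 1))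

/-- Position `j` is removed by the 01-elimination. -/
def removed01 (u : ℕ → ℕ) (j : ℕ) : Prop :=
  u j < u (j + 1) ∨ (1 ≤ j ∧ u (j - 1) < u j)

/-- The 10-elimination `Φ₁₀`: removal of all adjacent `10` pairs. -/
noncomputable def elim10 (u : ℕ → ℕ) : ℕ → ℕ :=
  fun j => u (Nat.nth (fun i => ¬ removed10 u i) j)

/-- The 01-elimination `Φ₀₁`: removal of all adjacent `01` pairs. -/
noncomputable def elim01 (u : ℕ → ℕ) : ℕ → ℕ :=
  fun j => u (Nat.nth (fun i => ¬ removed01 u i) j)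

/-- Removal of the two entries at positions `a`, `a+1`. -/
def phiElim (a : ℕ) (u : ℕ → ℕ) : ℕ → ℕ := fun j => if j < a then u j else u (j + 2)

open Classical in
/-- The descent positions, listed in decreasing order. -/
noncomputable def descList (u : ℕ → ℕ) : List ℕ :=
  if h : (descSet u).Finite then (h.toFinset.sort (· ≤ ·)).reverse else []

open Classical in
/-- The ascent positions, listed in decreasing order. -/
noncomputable def ascList (u : ℕ → ℕ) : List ℕ :=
  if h : (ascSet u).Finite then (h.toFinset.sort (· ≤ ·)).reverse else []

/-- Processing the descents `d₁ > d₂ > ⋯` of the original sequence, perform the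
successive eliminations and record those positions whose elimination strictly
decreases the descent number (the "0-solitons"). -/
noncomputable def rig10Aux : List ℕ → (ℕ → ℕ) → List ℕ
  | [], _ => []
  | d :: ds, u =>
    if desN (phiElim d u) < desN u then d :: rig10Aux ds (phiElim d u)
    else rig10Aux ds (phiElim d u)

/-- The analogue of `rig10Aux` for 01-eliminations. -/
noncomputable def rig01Aux : List ℕ → (ℕ → ℕ) → List ℕ
  | [], _ => []
  | a :: as, u =>
    if ascN (phiElim a u) < ascN u then a :: rig01Aux as (phiElim a u)
    else rig01Aux as (phiElim a u)

/-- The renumbering function `f_c` associated with a set `S ⊆ ℕ` of positions: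
`f_S n = n` for `n < 0`, `f_S` stays constant at each `c ∈ S` and `c+1`, and
increases by one at every other nonnegative integer. -/
noncomputable def fren (S : Set ℕ) (n : ℤ) : ℤ :=
  n - ({m : ℕ | (m : ℤ) ≤ n ∧ (m ∈ S ∨ ∃ k ∈ S, m = k + 1)}.ncard : ℤ)

/-- The 10-rigging `ρ₁₀(u)` as a list (in decreasing order of positions). -/
noncomputable def rho10List (u : ℕ → ℕ) : List ℤ :=
  (rig10Aux (descList u) u).map (fun i => fren (descSet u) (i : ℤ))

/-- The 01-rigging `ρ₀₁(u)` as a list (in decreasing order of positions). -/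
noncomputable def rho01List (u : ℕ → ℕ) : List ℤ :=
  (rig01Aux (ascList u) u).map (fun i => fren (ascSet u) (i : ℤ))

/-- The 10-rigging as a multiset. -/
noncomputable def rho10 (u : ℕ → ℕ) : Multiset ℤ := (rho10List u : Multiset ℤ)

/-- The 01-rigging as a multiset. -/
noncomputable def rho01 (u : ℕ → ℕ) : Multiset ℤ := (rho01List u : Multiset ℤ)

/-- The (infinite-capacity) carrier of the Takahashi-Satsuma evolution:
`v 0 = 0`, `v (j+1) = v j - min (v j) (1 - u j) + u j`. -/
def car (u : ℕ → ℕ) : ℕ → ℕ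
  | 0 => 0
  | j + 1 => car u j - min (car u j) (1 - u j) + u j

/-- The Takahashi-Satsuma time evolution `T`. -/
def bbsT (u : ℕ → ℕ) : ℕ → ℕ := fun j => min (car u j) (1 - u j)

/-- The carrier of capacity `M`. -/
def carM (M : ℕ) (u : ℕ → ℕ) : ℕ → ℕ
  | 0 => 0
  | j + 1 => carM M u j - min (carM M u j) (1 - u j) + min (u j) (M - carM M u j)

/-- The time evolution `T_M` with carrier capacity `M` and box capacity `1`. -/
def TM (M : ℕ) (u : ℕ → ℕ) : ℕ → ℕ := fun j =>
  u j + min (carM M u j) (1 - u j) - min (u j) (M - carM M u j)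

/-- Interlacing condition `d₁ > a₁ > d₂ > a₂ > ⋯ > d_N > a_N ≥ 0`
(0-indexed: `a k < d k` and `d (k+1) < a k`). -/
def Interlacing (N : ℕ) (a d : Fin N → ℕ) : Prop :=
  (∀ k, a k < d k) ∧ ∀ (k : Fin N) (h : (k : ℕ) + 1 < N), d ⟨(k : ℕ) + 1, h⟩ < a k

open Classical in
/-- The state `u(a₁,…,a_N; d₁,…,d_N)`: `u j = 1` iff `a k < j ≤ d k` for some `k`. -/
noncomputable def buildState (N : ℕ) (a d : Fin N → ℕ) : ℕ → ℕ :=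
  fun j => if ∃ k, a k < j ∧ j ≤ d k then 1 else 0

/-- The lattice-word condition: every initial segment contains at least as many
`0`s as `1`s. -/
def IsLattice (u : ℕ → ℕ) : Prop :=
  IsState u ∧ ∀ k : ℕ, {j | j ≤ k ∧ u j = 1}.ncard ≤ {j | j ≤ k ∧ u j = 0}.ncard

namespace BoxBall

/-- The complementary word, obtained by exchanging `0` and `1`. -/
def compl (u : ℕ → ℕ) : ℕ → ℕ := fun j => 1 - u j

/-- The value of `u` at the first repeated letter at or after position `d`. -/
noncomputable def endLetter (u : ℕ → ℕ) (d : ℕ) : ℕ := u (sInf {j | d ≤ j ∧ u j = u (j + 1)})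

/-- The excess of `0`s over `1`s among the first `m` letters. -/
def excess (u : ℕ → ℕ) (m : ℕ) : ℤ := ∑ i ∈ Finset.range m, (1 - 2 * (u i : ℤ))

/-- The criterion for a descent `d` to be recorded in the 10-rigging. -/
def Recorded (u : ℕ → ℕ) (d : ℕ) : Prop := d = 0 ∨ u (d - 1) = 0 ∨ endLetter u d = 1

/-- The position `m` belongs to a pair `{k, k + 1}` with `k ∈ S`. -/
def InPair (S : Set ℕ) (m : ℕ) : Prop := m ∈ S ∨ ∃ k ∈ S, m = k + 1

section Words

variable {u : ℕ → ℕ}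

theorem mem_descSet {j : ℕ} : j ∈ descSet u ↔ u (j + 1) < u j := Iff.rfl

theorem mem_ascSet {j : ℕ} : j ∈ ascSet u ↔ u j < u (j + 1) := Iff.rfl

theorem succ_notMem_descSet (hb : ∀ j, u j ≤ 1) : ∀ s ∈ descSet u, s + 1 ∉ descSet u := by
  intro s hs h
  have := hb s
  simp only [mem_descSet] at *
  omega

theorem succ_notMem_ascSet (hb : ∀ j, u j ≤ 1) : ∀ s ∈ ascSet u, s + 1 ∉ ascSet u := by
  intro s hs h
  have := hb (s + 1 + 1)
  simp only [mem_ascSet] at *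
  omega

theorem removed10_iff (j : ℕ) : removed10 u j ↔ InPair (descSet u) j := by
  unfold removed10 InPair
  refine or_congr Iff.rfl ⟨fun ⟨h1, h2⟩ => ⟨j - 1, ?_, by omega⟩, ?_⟩
  · rw [mem_descSet, Nat.sub_add_cancel h1]
    exact h2
  · rintro ⟨k, hk, rfl⟩
    exact ⟨by omega, hk⟩

theorem removed01_iff (j : ℕ) : removed01 u j ↔ InPair (ascSet u) j := by
  unfold removed01 InPair
  refine or_congr Iff.rfl ⟨fun ⟨h1, h2⟩ => ⟨j - 1, ?_, by omega⟩, ?_⟩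
  · rw [mem_ascSet, Nat.sub_add_cancel h1]
    exact h2
  · rintro ⟨k, hk, rfl⟩
    exact ⟨by omega, hk⟩

theorem endLetter_of_eq {d : ℕ} (h : u d = u (d + 1)) : endLetter u d = u d := by
  have : IsLeast {j | d ≤ j ∧ u j = u (j + 1)} d := ⟨⟨le_rfl, h⟩, fun j hj => hj.1⟩
  rw [endLetter, this.csInf_eq]

theorem endLetter_of_ne {d : ℕ} (h : u d ≠ u (d + 1)) : endLetter u d = endLetter u (d + 1) := by
  have : {j | d ≤ j ∧ u j = u (j + 1)} = {j | d + 1 ≤ j ∧ u j = u (j + 1)} := by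
    ext j
    refine ⟨fun ⟨h1, h2⟩ => ⟨?_, h2⟩, fun ⟨h1, h2⟩ => ⟨by omega, h2⟩⟩
    rcases h1.eq_or_lt with rfl | h1
    · exact absurd h2 h
    · exact h1
  rw [endLetter, endLetter, this]

theorem endLetter_compl (hb : ∀ j, u j ≤ 1) (d : ℕ) :
    endLetter (compl u) d = 1 - endLetter u d := by
  have : {j | d ≤ j ∧ compl u j = compl u (j + 1)} = {j | d ≤ j ∧ u j = u (j + 1)} := by
    ext j
    have h1 := hb j
    have h2 := hb (j + 1)
    simp only [compl, Set.mem_ofPred_eq]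
    omega
  rw [endLetter, endLetter, this, compl]

theorem descSet_compl (hb : ∀ j, u j ≤ 1) : descSet (compl u) = ascSet u := by
  ext j
  have h1 := hb j
  have h2 := hb (j + 1)
  simp only [compl, mem_descSet, mem_ascSet]
  omega

theorem excess_succ (u : ℕ → ℕ) (m : ℕ) : excess u (m + 1) = excess u m + (1 - 2 * (u m : ℤ)) := by
  rw [excess, excess, Finset.sum_range_succ]

theorem endLetter_zero_of_excess (hb : ∀ j, u j ≤ 1) (h0 : u 0 = 0)
    (hc : ∃ B, u B = u (B + 1)) (hl : ∀ m, 0 ≤ excess u m) : endLetter u 0 = 0 := by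
  set S := {j | 0 ≤ j ∧ u j = u (j + 1)} with hS
  obtain ⟨B, hB⟩ := hc
  have hmem : sInf S ∈ S := Nat.sInf_mem ⟨B, by omega, hB⟩
  have key : ∀ i ≤ sInf S, excess u i = u i := by
    intro i
    induction i with
    | zero => simp [excess, h0]
    | succ i ih =>
      intro hi
      have hn : i ∉ S := Nat.notMem_of_lt_sInf hi
      have h1 := hb i
      have h2 := hb (i + 1)
      have h3 : u i ≠ u (i + 1) := fun h => hn ⟨by omega, h⟩
      rw [excess_succ, ih (by omega)]
      omega
  have h1 := key _ le_rfl
  have h2 := hl (sInf S + 1 + 1)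
  rw [excess_succ, excess_succ, h1] at h2
  have h3 := hb (sInf S)
  have h4 : u (sInf S) = u (sInf S + 1) := hmem.2
  change u (sInf S) = 0
  omega

end Words

section Counting

open Classical in
theorem count_not_inPair {S : Set ℕ} (hS : ∀ s ∈ S, s + 1 ∉ S) (m : ℕ) :
    (Nat.count (fun j => ¬ InPair S j) (m + 1) : ℤ) =
      m + 1 - Nat.count (· ∈ S) m - Nat.count (· ∈ S) (m + 1) := by
  induction m with
  | zero =>
    by_cases h : 0 ∈ S <;> simp [Nat.count_succ, InPair, h]
  | succ m ih =>
    rw [Nat.count_succ, Nat.count_succ (· ∈ S) (m + 1)]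
    have h3 := Nat.count_succ (· ∈ S) m
    have h4 : InPair S (m + 1) ↔ (m + 1 ∈ S ∨ m ∈ S) := by
      simp [InPair]
    have h5 := hS m
    simp only [h4]
    by_cases h1 : m + 1 ∈ S <;> by_cases h2 : m ∈ S
    · exact absurd h1 (h5 h2)
    all_goals
      simp only [h1, h2, if_true, if_false, or_self, or_false, false_or, not_true, not_false_iff]
        at h3 ⊢
      push_cast
      omega

open Classical in
theorem fren_eq {S : Set ℕ} (hS : ∀ s ∈ S, s + 1 ∉ S) (n : ℕ) :
    fren S n = n - Nat.count (· ∈ S) n - Nat.count (· ∈ S) (n + 1) := by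
  have h1 := count_not_inPair hS n
  have h2 : {m : ℕ | (m : ℤ) ≤ n ∧ (m ∈ S ∨ ∃ k ∈ S, m = k + 1)}.ncard =
      Nat.count (InPair S) (n + 1) := by
    rw [Nat.count_eq_card_filter_range, ← Set.ncard_coe_finset]
    congr 1
    ext m
    rw [Finset.coe_filter]
    simp [InPair]
  have h3 : Nat.count (InPair S) (n + 1) + Nat.count (fun j => ¬ InPair S j) (n + 1) = n + 1 := by
    rw [Nat.count_eq_card_filter_range, Nat.count_eq_card_filter_range,
      Finset.card_filter_add_card_filter_not, Finset.card_range]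
  rw [fren, h2]
  omega

open Classical in
theorem count_ascSet {u : ℕ → ℕ} (hb : ∀ j, u j ≤ 1) (h0 : u 0 = 0) (m : ℕ) :
    Nat.count (· ∈ ascSet u) m = Nat.count (· ∈ descSet u) m + u m := by
  induction m with
  | zero => simp [h0]
  | succ m ih =>
    have h1 := hb m
    have h2 := hb (m + 1)
    rw [Nat.count_succ, Nat.count_succ, ih]
    simp only [mem_ascSet, mem_descSet]
    split_ifs <;> omega

end Counting

section Riggings

variable {u c : ℕ → ℕ} {d : ℕ}

theorem phiElim_of_lt {j : ℕ} (h : j < d) : phiElim d c j = c j := if_pos h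

theorem phiElim_of_le {j : ℕ} (h : d ≤ j) : phiElim d c j = c (j + 2) := if_neg (by omega)

theorem phiElim_le_one (hb : ∀ j, c j ≤ 1) (d j : ℕ) : phiElim d c j ≤ 1 := by
  unfold phiElim
  split_ifs
  exacts [hb _, hb _]

theorem descSet_eq_insert (hb : ∀ j, c j ≤ 1) (hd : d ∈ descSet c) :
    descSet c = insert d
      ((fun j => if j < d then j else j + 2) '' (descSet (phiElim d c) \ {j | j + 1 = d})) := by
  rw [mem_descSet] at hd
  have hbd := hb d
  ext j
  constructor
  · intro hj
    rw [mem_descSet] at hj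
    rcases lt_trichotomy j d with h | rfl | h
    · refine Or.inr ⟨j, ⟨?_, ?_⟩, if_pos h⟩
      · have : j + 1 ≠ d := by
          rintro rfl
          have := hb j
          omega
        rw [mem_descSet, phiElim_of_lt h, phiElim_of_lt (by omega)]
        exact hj
      · rintro (rfl : j + 1 = d)
        have := hb j
        omega
    · exact Or.inl rfl
    · have h1 : j ≠ d + 1 := by
        rintro rfl
        omega
      obtain ⟨i, rfl⟩ : ∃ i, j = i + 2 := ⟨j - 2, by omega⟩
      refine Or.inr ⟨i, ⟨?_, ?_⟩, if_neg (by omega)⟩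
      · rw [mem_descSet, phiElim_of_le (by omega), phiElim_of_le (by omega)]
        exact hj
      · simp only [Set.mem_ofPred_eq]
        omega
  · rintro (rfl | ⟨i, ⟨hi, hne⟩, rfl⟩)
    · exact hd
    · simp only [Set.mem_ofPred_eq] at hne
      rw [mem_descSet] at hi
      dsimp only
      split_ifs with h
      · rwa [phiElim_of_lt h, phiElim_of_lt (by omega)] at hi
      · rwa [phiElim_of_le (by omega), phiElim_of_le (by omega)] at hi

theorem injective_skip (d : ℕ) : Function.Injective fun j => if j < d then j else j + 2 := by
  intro i j h
  dsimp only at h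
  split_ifs at h <;> omega

theorem finite_descSet_phiElim (hb : ∀ j, c j ≤ 1) (hd : d ∈ descSet c)
    (hf : (descSet c).Finite) : (descSet (phiElim d c)).Finite := by
  rw [descSet_eq_insert hb hd] at hf
  have h1 := (hf.subset (Set.subset_insert _ _)).of_finite_image (injective_skip d).injOn
  refine (h1.union (Set.finite_singleton (d - 1))).subset fun j hj => ?_
  by_cases h : j + 1 = d
  · exact Or.inr (by simp; omega)
  · exact Or.inl ⟨hj, h⟩

theorem pred_mem_descSet_phiElim (hd : d ≠ 0) :
    d - 1 ∈ descSet (phiElim d c) ↔ c (d + 2) < c (d - 1) := by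
  obtain ⟨k, rfl⟩ : ∃ k, d = k + 1 := ⟨d - 1, by omega⟩
  rw [mem_descSet, Nat.add_sub_cancel, phiElim_of_lt (j := k) (by omega), phiElim_of_le le_rfl]

theorem desN_phiElim_lt_iff (hb : ∀ j, c j ≤ 1) (hd : d ∈ descSet c) (hf : (descSet c).Finite) :
    desN (phiElim d c) < desN c ↔ d = 0 ∨ c (d - 1) = 0 ∨ c (d + 2) = 1 := by
  have hf' := finite_descSet_phiElim hb hd hf
  have hcard : desN c = (descSet (phiElim d c) \ {j | j + 1 = d}).ncard + 1 := by
    rw [desN, descSet_eq_insert hb hd, Set.ncard_insert_of_notMem ?_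
      ((hf'.subset Set.sdiff_subset).image _), Set.ncard_image_of_injective _ (injective_skip d)]
    · rintro ⟨i, -, hi⟩
      dsimp only at hi
      split_ifs at hi <;> omega
  rw [hcard, desN]
  have h1 := hb (d - 1)
  have h2 := hb (d + 2)
  by_cases h : d - 1 ∈ descSet (phiElim d c) ∧ d ≠ 0
  · obtain ⟨h, hd0⟩ := h
    have hs : {j | j + 1 = d} = {d - 1} := by
      ext j
      simp only [Set.mem_ofPred_eq, Set.mem_singleton_iff]
      omega
    rw [hs, Set.ncard_sdiff_singleton_add_one h hf']
    rw [pred_mem_descSet_phiElim hd0] at h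
    omega
  · have hs : descSet (phiElim d c) \ {j | j + 1 = d} = descSet (phiElim d c) := by
      refine sdiff_eq_left.2 (Set.disjoint_left.2 fun j hj hj' => ?_)
      have hj' : j + 1 = d := hj'
      subst hj'
      exact h ⟨hj, by omega⟩
    rw [hs]
    refine ⟨fun _ => ?_, fun _ => by omega⟩
    by_contra! hc
    refine h ⟨?_, hc.1⟩
    rw [pred_mem_descSet_phiElim hc.1]
    omega

theorem endLetter_of_descent (hb : ∀ j, u j ≤ 1) (hd : d ∈ descSet u) :
    endLetter u d = endLetter u (d + 2) ∧ d + 2 ∈ descSet u ∨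
      endLetter u d = u (d + 2) ∧ d + 2 ∉ descSet u := by
  rw [mem_descSet] at hd
  have h0 := hb d
  have h1 := hb (d + 2)
  have h2 := hb (d + 3)
  rw [endLetter_of_ne hd.ne']
  by_cases h : u (d + 2) = 0
  · rw [endLetter_of_eq (by rw [h]; omega), mem_descSet]
    right
    omega
  · rw [endLetter_of_ne (by rw [show d + 1 + 1 = d + 2 from rfl]; omega)]
    by_cases h' : d + 2 ∈ descSet u
    · exact Or.inl ⟨rfl, h'⟩
    · refine Or.inr ⟨endLetter_of_eq ?_, h'⟩
      rw [mem_descSet] at h'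
      change u (d + 2) = u (d + 2 + 1)
      change ¬ u (d + 3) < _ at h'
      change u (d + 2) = u (d + 3)
      omega

open Classical in
theorem rig10Aux_eq_filter (hu : ∀ j, u j ≤ 1) (L : List ℕ) :
    ∀ c : ℕ → ℕ, (∀ j, c j ≤ 1) → (descSet c).Finite → L.Pairwise (· > ·) →
      (∀ d ∈ L, d ∈ descSet u) → (∀ d ∈ L, ∀ i ∈ descSet u, i < d → i ∈ L) →
      (∀ d ∈ L.head?, (∀ j ≤ d + 1, c j = u j) ∧ c (d + 2) = endLetter u d) →
      rig10Aux L c = L.filter (Recorded u) := by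
  induction L with
  | nil => intros; rfl
  | cons d L ih =>
    intro c hc hf hs hL hcl hhead
    obtain ⟨hag, hend⟩ := hhead d rfl
    have hdu : d ∈ descSet u := hL d List.mem_cons_self
    have hdc : d ∈ descSet c := by
      rw [mem_descSet, hag _ le_rfl, hag _ (by omega)]
      exact hdu
    have hrec : desN (phiElim d c) < desN c ↔ Recorded u d := by
      rw [desN_phiElim_lt_iff hc hdc hf, hend, hag _ (by omega), Recorded]
    rw [List.pairwise_cons] at hs
    have hnext := ih (phiElim d c) (phiElim_le_one hc d) (finite_descSet_phiElim hc hdc hf) hs.2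
      (fun i hi => hL i (List.mem_cons_of_mem _ hi))
      (fun i hi k hk hki => by
        rcases List.mem_cons.1 (hcl i (List.mem_cons_of_mem _ hi) k hk hki) with rfl | h
        · exact absurd (hs.1 i hi) (by omega)
        · exact h)
      (by
        intro i hi
        have hiL : i ∈ L := List.mem_of_mem_head? hi
        have hid : i < d := hs.1 i hiL
        have hiu := hL i (List.mem_cons_of_mem _ hiL)
        have hne : i + 1 ≠ d := by
          rintro rfl
          exact succ_notMem_descSet hu i hiu hdu
        refine ⟨fun j hj => ?_, ?_⟩
        · rw [phiElim_of_lt (by omega), hag _ (by omega)]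
        · rcases (show i + 2 ≤ d by omega).eq_or_lt with rfl | hlt
          · rw [phiElim_of_le le_rfl, hend]
            rcases endLetter_of_descent hu hiu with h | h
            · exact h.1.symm
            · exact absurd hdu h.2
          · rw [phiElim_of_lt hlt, hag _ (by omega)]
            rcases endLetter_of_descent hu hiu with h | h
            · exfalso
              have h1 := hcl d List.mem_cons_self _ h.2 hlt
              rcases List.mem_cons.1 h1 with h1 | h1
              · omega
              · obtain ⟨L', rfl⟩ : ∃ L', L = i :: L' := by
                  cases L with
                  | nil => simp at hi
                  | cons a L' =>
                    simp only [List.head?_cons, Option.mem_some_iff] at hi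
                    exact ⟨L', by rw [hi]⟩
                rcases List.mem_cons.1 h1 with h1 | h1
                · omega
                · have := (List.pairwise_cons.1 hs.2).1 _ h1
                  omega
            · exact h.1.symm)
    rw [rig10Aux, List.filter_cons, hnext]
    simp only [hrec, decide_eq_true_eq]

theorem mem_descList (hf : (descSet u).Finite) : d ∈ descList u ↔ d ∈ descSet u := by
  simp [descList, hf]

theorem pairwise_descList (u : ℕ → ℕ) : (descList u).Pairwise (· > ·) := by
  unfold descList
  split_ifs with h
  · rw [List.pairwise_reverse]
    exact Finset.sortedLT_sort _ |>.pairwise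
  · exact List.Pairwise.nil

theorem rho10List_eq (u : ℕ → ℕ) :
    rho10List u = (rig10Aux (descList u) u).map (fun i : ℕ => fren (descSet u) (i : ℤ)) := by
  simp [rho10List, ← List.map_eq_flatMap]

open Classical in
theorem rho10_eq_map (hb : ∀ j, u j ≤ 1) (hf : (descSet u).Finite) :
    rho10 u = (hf.toFinset.filter (Recorded u)).val.map (fun i : ℕ => fren (descSet u) (i : ℤ)) := by
  have h : rig10Aux (descList u) u = (descList u).filter (Recorded u) := by
    refine rig10Aux_eq_filter hb _ u hb hf (pairwise_descList u) (fun d => (mem_descList hf).1)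
      (fun _ _ i hi _ => (mem_descList hf).2 hi) fun d hd => ⟨fun _ _ => rfl, ?_⟩
    have hdL := List.mem_of_mem_head? hd
    rcases endLetter_of_descent hb ((mem_descList hf).1 hdL) with h | h
    · exfalso
      have hp := pairwise_descList u
      have hm := (mem_descList hf).2 h.2
      generalize descList u = L at *
      cases L with
      | nil => simp at hd
      | cons a L =>
        simp only [List.head?_cons, Option.mem_some_iff] at hd
        subst hd
        rcases List.mem_cons.1 hm with h1 | h1
        · omega
        · have := (List.pairwise_cons.1 hp).1 _ h1
          omega
    · exact h.1.symm
  rw [rho10, rho10List_eq, h, ← Multiset.map_coe, ← Multiset.filter_coe, Finset.filter_val]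
  congr 2
  rw [descList, dif_pos hf, Multiset.coe_reverse, Finset.sort_eq]

theorem rig01Aux_eq (L : List ℕ) : ∀ (c : ℕ → ℕ), (∀ j, c j ≤ 1) →
    rig01Aux L c = rig10Aux L (compl c) := by
  induction L with
  | nil => intros; rfl
  | cons a L ih =>
    intro c hc
    have h1 : phiElim a (compl c) = compl (phiElim a c) := by
      funext j
      simp only [phiElim, compl]
      split_ifs <;> rfl
    have h2 : ∀ c : ℕ → ℕ, (∀ j, c j ≤ 1) → desN (compl c) = ascN c := fun c hc => by
      rw [desN, ascN, descSet_compl hc]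
    rw [rig01Aux, rig10Aux, h1, h2 c hc, h2 _ (phiElim_le_one hc a), ih _ (phiElim_le_one hc a)]

theorem ascList_eq {v : ℕ → ℕ} (h : ascSet v = descSet u) : ascList v = descList u := by
  rw [ascList, descList]
  generalize ascSet v = S at h
  subst h
  rfl

theorem rho01_eq_rho10_compl (hb : ∀ j, u j ≤ 1) : rho01 u = rho10 (compl u) := by
  rw [rho01, rho10, rho01List, rho10List, ascList_eq (descSet_compl hb).symm, descSet_compl hb,
    rig01Aux_eq _ _ hb]

end Riggings

section Carrier

variable {u c : ℕ → ℕ} {d : ℕ}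

theorem ascSet_bbsT (hb : ∀ j, u j ≤ 1) : ascSet (bbsT u) = descSet u := by
  ext j
  have h1 := hb j
  have h2 := hb (j + 1)
  simp only [mem_ascSet, mem_descSet, bbsT, car]
  omega

theorem car_phiElim_of_le {j : ℕ} (h : j ≤ d) : car (phiElim d c) j = car c j := by
  induction j with
  | zero => rfl
  | succ j ih => rw [car, car, ih (by omega), phiElim_of_lt (by omega)]

theorem car_phiElim_of_ge (hb : ∀ j, c j ≤ 1) (hd : d ∈ descSet c) {j : ℕ} (h : d ≤ j) :
    car (phiElim d c) j = car c (j + 2) := by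
  induction j, h using Nat.le_induction with
  | base =>
    rw [mem_descSet] at hd
    have := hb d
    rw [car_phiElim_of_le le_rfl, car, car]
    omega
  | succ j hj ih =>
    rw [car, ih, phiElim_of_le hj, show j + 1 + 2 = j + 2 + 1 from rfl, car.eq_2 c (j + 2)]

theorem bbsT_phiElim (hb : ∀ j, c j ≤ 1) (hd : d ∈ descSet c) :
    bbsT (phiElim d c) = phiElim d (bbsT c) := by
  funext j
  rcases lt_or_ge j d with h | h
  · rw [phiElim_of_lt h, bbsT, bbsT, car_phiElim_of_le h.le, phiElim_of_lt h]
  · rw [phiElim_of_le h, bbsT, bbsT, car_phiElim_of_ge hb hd h, phiElim_of_le h]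

theorem ascN_bbsT (hb : ∀ j, u j ≤ 1) : ascN (bbsT u) = desN u := by
  rw [ascN, desN, ascSet_bbsT hb]

theorem rig01Aux_bbsT (L : List ℕ) : ∀ c : ℕ → ℕ, (∀ j, c j ≤ 1) → L.Pairwise (· > ·) →
    (∀ d ∈ L, d ∈ descSet c) → rig01Aux L (bbsT c) = rig10Aux L c := by
  induction L with
  | nil => intros; rfl
  | cons d L ih =>
    intro c hc hs hL
    have hd : d ∈ descSet c := hL d List.mem_cons_self
    rw [List.pairwise_cons] at hs
    have hnext := ih (phiElim d c) (phiElim_le_one hc d) hs.2 fun i hi => by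
      have h1 := hL i (List.mem_cons_of_mem _ hi)
      have h2 := hs.1 i hi
      have h3 : i + 1 ≠ d := by
        rintro rfl
        exact succ_notMem_descSet hc i h1 hd
      rw [mem_descSet, phiElim_of_lt h2, phiElim_of_lt (by omega)]
      exact h1
    rw [rig01Aux, rig10Aux, ← bbsT_phiElim hc hd, ascN_bbsT hc, ascN_bbsT (phiElim_le_one hc d),
      hnext]

theorem rho01_bbsT (hb : ∀ j, u j ≤ 1) (hf : (descSet u).Finite) : rho01 (bbsT u) = rho10 u := by
  rw [rho01, rho10, rho01List, rho10List, ascList_eq (ascSet_bbsT hb), ascSet_bbsT hb,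
    rig01Aux_bbsT _ _ hb (pairwise_descList u) fun d => (mem_descList hf).1]

end Carrier

/-- A binary word that starts with `0` and ends in `0`s. -/
structure FinWord (u : ℕ → ℕ) : Prop where
  zero : u 0 = 0
  le_one : ∀ j, u j ≤ 1
  tail : ∃ B, ∀ j ≥ B, u j = 0

/-- A finite word all of whose initial segments contain at least as many `0`s as `1`s. -/
structure LatticeWord (u : ℕ → ℕ) : Prop extends FinWord u where
  excess_nonneg : ∀ m, 0 ≤ excess u m

/-- Removal from `u` of the pairs `{k, k + 1}` with `k ∈ S`. -/
noncomputable def removePairs (S : Set ℕ) (u : ℕ → ℕ) : ℕ → ℕ :=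
  fun j => u (Nat.nth (fun i => ¬ InPair S i) j)

section Elimination

variable {u v : ℕ → ℕ} {S : Set ℕ}

theorem elim10_eq (u : ℕ → ℕ) : elim10 u = removePairs (descSet u) u := by
  have : removed10 u = InPair (descSet u) := funext fun j => propext (removed10_iff j)
  change (fun j => u (Nat.nth (fun i => ¬ removed10 u i) j)) = _
  rw [this]
  rfl

theorem elim01_eq (u : ℕ → ℕ) : elim01 u = removePairs (ascSet u) u := by
  have : removed01 u = InPair (ascSet u) := funext fun j => propext (removed01_iff j)
  change (fun j => u (Nat.nth (fun i => ¬ removed01 u i) j)) = _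
  rw [this]
  rfl

theorem infinite_not_inPair (h : ∃ B, ∀ j ≥ B, j ∉ S) :
    (Set.ofPred fun j => ¬ InPair S j).Infinite := by
  obtain ⟨B, hB⟩ := h
  refine Set.infinite_of_injective_forall_mem (f := fun k => B + 1 + k)
    (fun a b hab => by simpa using hab) fun k => ?_
  rintro (h | ⟨i, hi, h⟩)
  · exact hB _ (by omega) h
  · exact hB i (by omega) hi

open Classical in
theorem removePairs_count {m : ℕ} (h : ¬ InPair S m) :
    removePairs S u (Nat.count (fun j => ¬ InPair S j) m) = u m := by
  rw [removePairs, Nat.nth_count h]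

open Classical in
theorem eq_removePairs (hS : ∃ B, ∀ j ≥ B, j ∉ S)
    (h : ∀ m, ¬ InPair S m → v (Nat.count (fun j => ¬ InPair S j) m) = u m) :
    v = removePairs S u := by
  funext j
  have hi := infinite_not_inPair hS
  have := h _ (Nat.nth_mem_of_infinite hi j)
  rwa [Nat.count_nth_of_infinite hi] at this

theorem FinWord.descSet_tail (hu : FinWord u) : ∃ B, ∀ j ≥ B, j ∉ descSet u := by
  obtain ⟨B, hB⟩ := hu.tail
  refine ⟨B, fun j hj => ?_⟩
  rw [mem_descSet, hB j hj]
  omega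

theorem FinWord.ascSet_tail (hu : FinWord u) : ∃ B, ∀ j ≥ B, j ∉ ascSet u := by
  obtain ⟨B, hB⟩ := hu.tail
  refine ⟨B, fun j hj => ?_⟩
  rw [mem_ascSet, hB (j + 1) (by omega)]
  omega

theorem finite_of_tail (hS : ∃ B, ∀ j ≥ B, j ∉ S) : S.Finite := by
  obtain ⟨B, hB⟩ := hS
  refine (Set.finite_lt_nat B).subset fun j hj => ?_
  by_contra h
  exact hB j (not_lt.1 h) hj

theorem removePairs_tail (hS : ∃ B, ∀ j ≥ B, j ∉ S) (hu : ∃ B, ∀ j ≥ B, u j = 0) :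
    ∃ B, ∀ j ≥ B, removePairs S u j = 0 := by
  obtain ⟨B, hB⟩ := hu
  exact ⟨B, fun j hj => hB _ (hj.trans (Nat.nth_strictMono (infinite_not_inPair hS)).le_apply)⟩

open Classical in
theorem car_removePairs_count (hb : ∀ j, u j ≤ 1) (m : ℕ) :
    car (removePairs (descSet u) u) (Nat.count (fun j => ¬ InPair (descSet u) j) m) +
      (if 1 ≤ m ∧ u m < u (m - 1) then 1 else 0) = car u m := by
  induction m with
  | zero => simp [car]
  | succ m ih =>
    have h1 := hb m
    have h2 := hb (m + 1)
    rw [Nat.count_succ, Nat.add_sub_cancel, car]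
    by_cases h : InPair (descSet u) m
    · rw [if_neg (not_not.2 h), Nat.add_zero]
      rw [← removed10_iff, removed10] at h
      have h3 := hb (m - 1)
      split_ifs at ih ⊢ <;> omega
    · rw [if_pos h, car, removePairs_count h]
      rw [← removed10_iff, removed10] at h
      split_ifs at ih ⊢ <;> omega

open Classical in
theorem excess_removePairs_count (hb : ∀ j, u j ≤ 1) (m : ℕ) :
    excess (removePairs (ascSet u) u) (Nat.count (fun j => ¬ InPair (ascSet u) j) m) +
      (if 1 ≤ m ∧ u (m - 1) < u m then 1 else 0) = excess u m := by
  induction m with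
  | zero => simp [excess]
  | succ m ih =>
    have h1 := hb m
    have h2 := hb (m + 1)
    rw [Nat.count_succ, Nat.add_sub_cancel, excess_succ]
    by_cases h : InPair (ascSet u) m
    · rw [if_neg (not_not.2 h), Nat.add_zero]
      rw [← removed01_iff, removed01] at h
      have h3 := hb (m - 1)
      split_ifs at ih ⊢ <;> omega
    · rw [if_pos h, excess_succ, removePairs_count h]
      rw [← removed01_iff, removed01] at h
      split_ifs at ih ⊢ <;> omega

theorem elim01_bbsT (hu : FinWord u) : elim01 (bbsT u) = bbsT (elim10 u) := by
  classical
  rw [elim01_eq, ascSet_bbsT hu.le_one, elim10_eq]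
  refine (eq_removePairs hu.descSet_tail fun m hm => ?_).symm
  have h1 := car_removePairs_count hu.le_one m
  rw [bbsT, bbsT, removePairs_count hm]
  rw [← removed10_iff, removed10, not_or] at hm
  rw [if_neg hm.2, Nat.add_zero] at h1
  rw [h1]

theorem LatticeWord.elim01 (hu : LatticeWord u) : LatticeWord (elim01 u) := by
  classical
  have hex : ∀ m, 0 ≤ excess (_root_.elim01 u) m := by
    intro m
    have hi := infinite_not_inPair hu.ascSet_tail
    have hm := Nat.nth_mem_of_infinite hi m
    have h1 := excess_removePairs_count hu.le_one (Nat.nth (fun j => ¬ InPair (ascSet u) j) m)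
    rw [Nat.count_nth_of_infinite hi] at h1
    rw [← removed01_iff, removed01, not_or] at hm
    rw [if_neg hm.2, add_zero] at h1
    rw [elim01_eq, h1]
    exact hu.excess_nonneg _
  refine ⟨⟨?_, ?_, ?_⟩, hex⟩
  · have := hex 1
    simp only [excess, Finset.sum_range_one] at this
    omega
  · exact fun j => hu.le_one _
  · rw [elim01_eq]
    exact removePairs_tail hu.ascSet_tail hu.tail

theorem shift_zero (u : ℕ → ℕ) : shift u 0 = 0 := rfl

theorem shift_succ (u : ℕ → ℕ) (j : ℕ) : shift u (j + 1) = u j := rfl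

theorem elim10_eq_shift_elim01 (hu : FinWord u) : elim10 u = shift (elim01 u) := by
  classical
  rw [elim10_eq, elim01_eq]
  refine (eq_removePairs hu.descSet_tail fun m hm => ?_).symm
  have hb := hu.le_one
  cases m with
  | zero => rw [Nat.count_zero, shift_zero, hu.zero]
  | succ k =>
    have hm' := hm
    rw [← removed10_iff, removed10, not_or, Nat.add_sub_cancel] at hm'
    have hk := hb k
    have hk1 := hb (k + 1)
    have hk2 := hb (k + 2)
    have hD := count_not_inPair (succ_notMem_descSet hb) k
    have hA := count_not_inPair (succ_notMem_ascSet hb) k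
    have hA' := count_not_inPair (succ_notMem_ascSet hb) (k + 1)
    have e0 := count_ascSet hb hu.zero k
    have e1 := count_ascSet hb hu.zero (k + 1)
    have e2 := count_ascSet hb hu.zero (k + 2)
    have d1 := Nat.count_succ (· ∈ descSet u) k
    have d2 := Nat.count_succ (· ∈ descSet u) (k + 1)
    rw [if_neg (show k ∉ descSet u by rw [mem_descSet]; omega)] at d1
    rw [if_neg (show k + 1 ∉ descSet u from hm'.1)] at d2
    obtain ⟨hm1, hm2⟩ := hm'
    rw [show k + 1 + 1 = k + 2 from rfl] at *
    by_cases h : u (k + 1) = 0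
    · have hp : ¬ InPair (ascSet u) k := by
        rw [← removed01_iff, removed01]
        omega
      have hc := Nat.count_succ (fun j => ¬ InPair (ascSet u) j) k
      rw [if_pos hp] at hc
      have : Nat.count (fun j => ¬ InPair (descSet u) j) (k + 1) =
          Nat.count (fun j => ¬ InPair (ascSet u) j) k + 1 := by omega
      rw [this, shift_succ, removePairs_count hp]
      omega
    · have hp : ¬ InPair (ascSet u) (k + 2) := by
        rw [← removed01_iff, removed01, show k + 2 - 1 = k + 1 from rfl]
        have := hb (k + 2 + 1)
        omega
      have : Nat.count (fun j => ¬ InPair (descSet u) j) (k + 1) =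
          Nat.count (fun j => ¬ InPair (ascSet u) j) (k + 2) + 1 := by
        push_cast at hA'
        omega
      rw [this, shift_succ, removePairs_count hp]
      omega

theorem FinWord.elim10 (hu : FinWord u) : FinWord (elim10 u) := by
  refine ⟨?_, fun j => hu.le_one _, ?_⟩
  · rw [elim10_eq_shift_elim01 hu, shift_zero]
  · rw [elim10_eq]
    exact removePairs_tail hu.descSet_tail hu.tail

theorem FinWord.shift (hu : FinWord u) : FinWord (shift u) := by
  refine ⟨rfl, fun j => ?_, ?_⟩
  · cases j with
    | zero => exact Nat.zero_le _
    | succ j => exact hu.le_one j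
  · obtain ⟨B, hB⟩ := hu.tail
    refine ⟨B + 1, fun j hj => ?_⟩
    obtain ⟨i, rfl⟩ : ∃ i, j = i + 1 := ⟨j - 1, by omega⟩
    exact hB i (by omega)

theorem zero_notMem_descSet_shift (u : ℕ → ℕ) : 0 ∉ descSet (shift u) :=
  Nat.not_lt_zero _

theorem inPair_descSet_shift_succ (j : ℕ) :
    InPair (descSet (shift u)) (j + 1) ↔ InPair (descSet u) j := by
  refine or_congr Iff.rfl ⟨?_, ?_⟩
  · rintro ⟨k, hk, h⟩
    cases k with
    | zero => exact absurd hk (zero_notMem_descSet_shift u)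
    | succ k => exact ⟨k, hk, by omega⟩
  · rintro ⟨k, hk, rfl⟩
    exact ⟨k + 1, hk, rfl⟩

theorem elim10_shift (hu : FinWord u) : elim10 (shift u) = shift (elim10 u) := by
  classical
  rw [elim10_eq, elim10_eq]
  refine (eq_removePairs hu.shift.descSet_tail fun m hm => ?_).symm
  cases m with
  | zero => rfl
  | succ k =>
    have h0 : ¬ InPair (descSet (shift u)) 0 := by
      rintro (h | ⟨i, -, hi⟩)
      · exact zero_notMem_descSet_shift u h
      · omega
    rw [Nat.count_succ', if_pos h0, shift_succ, shift_succ]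
    simp only [inPair_descSet_shift_succ] at hm ⊢
    exact removePairs_count hm

theorem elim10_iterate_shift (hu : FinWord u) (k : ℕ) :
    elim10 (shift^[k] u) = shift^[k] (elim10 u) := by
  induction k generalizing u with
  | zero => rfl
  | succ k ih => rw [Function.iterate_succ_apply, Function.iterate_succ_apply, ih hu.shift,
      elim10_shift hu]

theorem LatticeWord.elim01_iterate (hu : LatticeWord u) (k : ℕ) :
    LatticeWord (_root_.elim01^[k] u) := by
  induction k with
  | zero => exact hu
  | succ k ih =>
    rw [Function.iterate_succ_apply']
    exact ih.elim01

theorem FinWord.elim10_iterate (hu : FinWord u) (k : ℕ) : FinWord (_root_.elim10^[k] u) := by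
  induction k with
  | zero => exact hu
  | succ k ih =>
    rw [Function.iterate_succ_apply']
    exact ih.elim10

theorem elim01_iterate_bbsT (hu : FinWord u) (k : ℕ) :
    elim01^[k] (bbsT u) = bbsT (elim10^[k] u) := by
  induction k with
  | zero => rfl
  | succ k ih =>
    rw [Function.iterate_succ_apply', Function.iterate_succ_apply', ih,
      elim01_bbsT (hu.elim10_iterate k)]

theorem elim10_iterate_eq_shift (hu : LatticeWord u) (k : ℕ) :
    elim10^[k] u = shift^[k] (elim01^[k] u) := by
  induction k with
  | zero => rfl
  | succ k ih =>
    have h := (hu.elim01_iterate k).toFinWord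
    rw [Function.iterate_succ_apply' elim10, ih, elim10_iterate_shift h, elim10_eq_shift_elim01 h,
      ← Function.iterate_succ_apply, ← Function.iterate_succ_apply' elim01]

end Elimination

section Shift

variable {u : ℕ → ℕ}

theorem endLetter_shift (hu : FinWord u) (d : ℕ) :
    endLetter (shift u) (d + 1) = endLetter u d := by
  obtain ⟨B, hB⟩ := hu.tail
  set S := {j | d ≤ j ∧ u j = u (j + 1)} with hS
  have hne : S.Nonempty :=
    ⟨B + d, by omega, by rw [hB _ (by omega), hB _ (by omega)]⟩
  have hl : IsLeast {j | d + 1 ≤ j ∧ shift u j = shift u (j + 1)} (sInf S + 1) := by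
    have hm : sInf S ∈ S := Nat.sInf_mem hne
    refine ⟨⟨Nat.succ_le_succ hm.1, hm.2⟩, ?_⟩
    rintro j ⟨h1, h2⟩
    obtain ⟨i, rfl⟩ : ∃ i, j = i + 1 := ⟨j - 1, by omega⟩
    exact Nat.succ_le_succ (Nat.sInf_le ⟨by omega, h2⟩)
  rw [endLetter, hl.csInf_eq, shift_succ, endLetter]

theorem recorded_shift (hu : FinWord u) (d : ℕ) :
    Recorded (shift u) (d + 1) ↔ Recorded u d := by
  rw [Recorded, Recorded, endLetter_shift hu, Nat.add_sub_cancel]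
  cases d with
  | zero => simp [shift_zero]
  | succ d => simp [shift_succ]

theorem fren_descSet_shift (hu : FinWord u) (d : ℕ) :
    fren (descSet (shift u)) ((d + 1 : ℕ) : ℤ) = fren (descSet u) (d : ℤ) + 1 := by
  classical
  have h : ∀ n, Nat.count (· ∈ descSet (shift u)) (n + 1) = Nat.count (· ∈ descSet u) n := by
    intro n
    rw [Nat.count_succ', if_neg (zero_notMem_descSet_shift u)]
    rfl
  rw [fren_eq (succ_notMem_descSet hu.shift.le_one), fren_eq (succ_notMem_descSet hu.le_one), h, h]
  push_cast
  ring

theorem rho10_shift (hu : FinWord u) : rho10 (shift u) = (rho10 u).map (· + 1) := by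
  classical
  rw [rho10_eq_map hu.le_one (finite_of_tail hu.descSet_tail),
    rho10_eq_map hu.shift.le_one (finite_of_tail hu.shift.descSet_tail), Multiset.map_map]
  symm
  refine Multiset.map_eq_map_of_bij_of_nodup _ _ (Finset.nodup _) (Finset.nodup _)
    (fun d _ => d + 1) ?_ ?_ ?_ ?_
  · intro d hd
    rw [Finset.mem_val, Finset.mem_filter, Set.Finite.mem_toFinset] at hd ⊢
    exact ⟨hd.1, (recorded_shift hu d).2 hd.2⟩
  · intro a _ b _ h
    exact Nat.succ_injective h
  · intro b hb
    rw [Finset.mem_val, Finset.mem_filter, Set.Finite.mem_toFinset] at hb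
    cases b with
    | zero => exact absurd hb.1 (zero_notMem_descSet_shift u)
    | succ d =>
      refine ⟨d, ?_, rfl⟩
      rw [Finset.mem_val, Finset.mem_filter, Set.Finite.mem_toFinset]
      exact ⟨hb.1, (recorded_shift hu d).1 hb.2⟩
  · exact fun d _ => (fren_descSet_shift hu d).symm

theorem rho10_iterate_shift (hu : FinWord u) (k : ℕ) :
    rho10 (shift^[k] u) = (rho10 u).map (· + (k : ℤ)) := by
  induction k generalizing u with
  | zero => simp
  | succ k ih =>
    rw [Function.iterate_succ_apply, ih hu.shift, rho10_shift hu, Multiset.map_map]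
    refine Multiset.map_congr rfl fun x _ => ?_
    simp only [Function.comp_apply, Nat.cast_succ]
    ring

end Shift

section Exchange

variable {w : ℕ → ℕ}

theorem recorded_compl (hb : ∀ j, w j ≤ 1) (a : ℕ) :
    Recorded (compl w) a ↔ a = 0 ∨ w (a - 1) = 1 ∨ endLetter w a = 0 := by
  have h1 := hb (a - 1)
  have h2 : endLetter w a ≤ 1 := hb _
  rw [Recorded, endLetter_compl hb, compl]
  omega

theorem rho10_eq_rho01_add_one (hw : LatticeWord w) : rho10 w = (rho01 w).map (· + 1) := by
  classical
  have hb := hw.le_one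
  have h0 : endLetter w 0 = 0 := by
    obtain ⟨B, hB⟩ := hw.tail
    exact endLetter_zero_of_excess hb hw.zero
      ⟨B, by rw [hB _ le_rfl, hB _ (by omega)]⟩ hw.excess_nonneg
  have he : ∀ d, endLetter w d ≤ 1 := fun d => hb _
  have hbc : ∀ j, compl w j ≤ 1 := fun j => Nat.sub_le _ _
  have hfa : (descSet (compl w)).Finite := by
    rw [descSet_compl hb]
    exact finite_of_tail hw.ascSet_tail
  have hnext : ∀ d ∈ descSet w, endLetter w d = 1 →
      w (d + 1) = 0 ∧ w (d + 2) = 1 ∧ endLetter w (d + 1) = 1 := by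
    intro d hd h
    rw [mem_descSet] at hd
    have h1 := hb d
    have h2 := hb (d + 2)
    rw [endLetter_of_ne hd.ne'] at h
    refine ⟨by omega, ?_, h⟩
    by_contra hne
    rw [endLetter_of_eq (by rw [show d + 1 + 1 = d + 2 from rfl]; omega)] at h
    omega
  have hprev : ∀ d ∈ descSet w, endLetter w d = 0 → Recorded w d →
      1 ≤ d ∧ w (d - 1) = 0 ∧ endLetter w (d - 1) = 0 := by
    intro d hd h hr
    rw [mem_descSet] at hd
    have h1 : d ≠ 0 := by
      rintro rfl
      have := hw.zero
      omega
    have h2 : w (d - 1) = 0 := by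
      unfold Recorded at hr
      omega
    refine ⟨by omega, h2, ?_⟩
    rw [endLetter_of_ne, Nat.sub_add_cancel (by omega), h]
    rw [Nat.sub_add_cancel (by omega)]
    omega
  rw [rho01_eq_rho10_compl hb, rho10_eq_map hbc hfa,
    rho10_eq_map hb (finite_of_tail hw.descSet_tail), Multiset.map_map]
  refine Multiset.map_eq_map_of_bij_of_nodup _ _ (Finset.nodup _) (Finset.nodup _)
    (fun d _ => if endLetter w d = 1 then d + 1 else d - 1) ?_ ?_ ?_ ?_
  · intro d hd
    rw [Finset.mem_val, Finset.mem_filter, Set.Finite.mem_toFinset] at hd ⊢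
    have hd1 := hd.1
    rw [mem_descSet] at hd1
    have h2 := hb d
    rw [descSet_compl hb, recorded_compl hb, mem_ascSet]
    split_ifs with h
    · have h3 := hnext d hd.1 h
      rw [show d + 1 + 1 = d + 2 from rfl, Nat.add_sub_cancel]
      omega
    · have h3 := hprev d hd.1 (by have := he d; omega) hd.2
      rw [Nat.sub_add_cancel h3.1]
      omega
  · intro a ha b hb' hab
    rw [Finset.mem_val, Finset.mem_filter, Set.Finite.mem_toFinset] at ha hb'
    have ea := he a
    have eb := he b
    split_ifs at hab with h1 h2 h2
    · omega
    · have h3 := hnext a ha.1 h1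
      have h4 := hprev b hb'.1 (by omega) hb'.2
      rw [← hab] at h4
      omega
    · have h3 := hnext b hb'.1 h2
      have h4 := hprev a ha.1 (by omega) ha.2
      rw [hab] at h4
      omega
    · have h3 := hprev a ha.1 (by omega) ha.2
      have h4 := hprev b hb'.1 (by omega) hb'.2
      omega
  · intro a ha
    rw [Finset.mem_val, Finset.mem_filter, Set.Finite.mem_toFinset, descSet_compl hb,
      recorded_compl hb, mem_ascSet] at ha
    obtain ⟨ha1, ha2⟩ := ha
    have h1 := hb (a + 1)
    have h2 := hb (a + 2)
    have h3 := he a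
    have hne := endLetter_of_ne ha1.ne
    by_cases h : endLetter w a = 1
    · have ha0 : a ≠ 0 := by
        rintro rfl
        omega
      have h4 : w (a - 1) = 1 := by omega
      obtain ⟨d, rfl⟩ : ∃ d, a = d + 1 := ⟨a - 1, by omega⟩
      rw [Nat.add_sub_cancel] at h4
      have h5 : endLetter w d = 1 := by rw [endLetter_of_ne (by omega), h]
      refine ⟨d, ?_, by rw [if_pos h5]⟩
      rw [Finset.mem_val, Finset.mem_filter, Set.Finite.mem_toFinset]
      exact ⟨by rw [mem_descSet]; omega, Or.inr (Or.inr h5)⟩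
    · have h5 : w (a + 2) = 0 := by
        by_contra h6
        rw [hne, endLetter_of_eq (by rw [show a + 1 + 1 = a + 2 from rfl]; omega)] at h
        omega
      refine ⟨a + 1, ?_, by rw [if_neg (by omega), Nat.add_sub_cancel]⟩
      rw [Finset.mem_val, Finset.mem_filter, Set.Finite.mem_toFinset]
      refine ⟨?_, Or.inr (Or.inl ?_)⟩
      · rw [mem_descSet, show a + 1 + 1 = a + 2 from rfl]
        omega
      · rw [Nat.add_sub_cancel]
        omega
  · intro d hd
    rw [Finset.mem_val, Finset.mem_filter, Set.Finite.mem_toFinset] at hd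
    have hd1 := hd.1
    rw [mem_descSet] at hd1
    have hbd := hb d
    have hA := count_ascSet hb hw.zero
    have a0 := hA d
    have a1 := hA (d + 1)
    have d1 := Nat.count_succ (· ∈ descSet w) d
    rw [if_pos hd.1] at d1
    rw [Function.comp_apply, descSet_compl hb, fren_eq (succ_notMem_descSet hb),
      fren_eq (succ_notMem_ascSet hb)]
    split_ifs with h
    · have h3 := hnext d hd.1 h
      have a2 := hA (d + 1 + 1)
      have d2 := Nat.count_succ (· ∈ descSet w) (d + 1)
      rw [if_neg (succ_notMem_descSet hb d hd.1)] at d2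
      rw [show w (d + 1 + 1) = 1 from h3.2.1] at a2
      omega
    · have h3 := hprev d hd.1 (by have := he d; omega) hd.2
      obtain ⟨i, rfl⟩ : ∃ i, d = i + 1 := ⟨d - 1, by omega⟩
      rw [Nat.add_sub_cancel] at h3 ⊢
      have ai := hA i
      have di := Nat.count_succ (· ∈ descSet w) i
      rw [if_neg (by rw [mem_descSet]; omega)] at di
      omega

end Exchange

theorem latticeWord_of_isLattice {u : ℕ → ℕ} (hu : IsLattice u) : LatticeWord u := by
  obtain ⟨⟨h0, hb, hf⟩, hl⟩ := hu
  refine ⟨⟨h0, hb, ?_⟩, fun m => ?_⟩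
  · obtain ⟨B, hB⟩ := hf.bddAbove
    refine ⟨B + 1, fun j hj => ?_⟩
    by_contra h
    have h1 := hb j
    have : j ≤ B := hB (show u j = 1 by omega)
    omega
  · cases m with
    | zero => simp [excess]
    | succ k =>
      have hset : ∀ v, {j | j ≤ k ∧ u j = v}.ncard =
          ((Finset.range (k + 1)).filter fun j => u j = v).card := by
        intro v
        rw [← Set.ncard_coe_finset]
        congr 1
        ext j
        rw [Finset.coe_filter]
        simp
      have h := hl k
      rw [hset, hset, Finset.card_filter, Finset.card_filter] at h
      have hex : excess u (k + 1) = (∑ i ∈ Finset.range (k + 1), if u i = 0 then 1 else 0 : ℕ) -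
          (∑ i ∈ Finset.range (k + 1), if u i = 1 then 1 else 0 : ℕ) := by
        rw [excess, Nat.cast_sum, Nat.cast_sum, ← Finset.sum_sub_distrib]
        refine Finset.sum_congr rfl fun i _ => ?_
        have := hb i
        split_ifs <;> omega
      rw [hex]
      omega

end BoxBall

/-- linearization of the box-ball evolution: the `n`-th
01-rigging of `T(u)` is the `n`-th 01-rigging of `u` shifted up by `n`. -/
theorem stmt11 (u : ℕ → ℕ) (hu : IsLattice u) (n : ℕ) (hn : 1 ≤ n) :
    rho01 (elim01^[n - 1] (bbsT u)) =
      (rho01 (elim01^[n - 1] u)).map (fun x => x + (n : ℤ)) := by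
  have hw := BoxBall.latticeWord_of_isLattice hu
  obtain ⟨k, rfl⟩ : ∃ k, n = k + 1 := ⟨n - 1, by omega⟩
  have hk := hw.elim01_iterate k
  have hv := hw.toFinWord.elim10_iterate k
  rw [Nat.add_sub_cancel, BoxBall.elim01_iterate_bbsT hw.toFinWord,
    BoxBall.rho01_bbsT hv.le_one (BoxBall.finite_of_tail hv.descSet_tail),
    BoxBall.elim10_iterate_eq_shift hw, BoxBall.rho10_iterate_shift hk.toFinWord,
    BoxBall.rho10_eq_rho01_add_one hk, Multiset.map_map]
  refine Multiset.map_congr rfl fun x _ => ?_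
  simp only [Function.comp_apply, Nat.cast_succ]
  ring
end

section
/- For every lattice word u with N ascents, there exists an integer K such that for all k ≥ K, writing Asc(T^k u) = {a_1(k) > ... > a_N(k)} and Des(T^k u) = {d_1(k) > ... > d_N(k)}, one has d_j(k) − a_j(k) = μ_j for all j and a_j(k) − d_{j+1}(k) ≥ μ_{j+1} for all j < N, where μ is the conjugate of the invariant partition λ(u). That is, the solitons are eventually well-separated with lengths given by μ. -/
/-- `μ_{j+1}`, the `(j+1)`-th part of the partition conjugate to
`λ(u) = (asc(Φ₀₁^{i}(u)))_{i≥0}`. -/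
noncomputable def muPart (u : ℕ → ℕ) (j : ℕ) : ℕ :=
  {i : ℕ | j + 1 ≤ ascN (elim01^[i] u)}.ncard

/-! ### Prepending entries to a sequence -/

/-- The sequence with first entry `x`, followed by `s`. -/
def consSeq (x : ℕ) (s : ℕ → ℕ) : ℕ → ℕ
  | 0 => x
  | n + 1 => s n

@[simp] theorem consSeq_zero (x : ℕ) (s : ℕ → ℕ) : consSeq x s 0 = x := rfl

@[simp] theorem consSeq_succ (x : ℕ) (s : ℕ → ℕ) (n : ℕ) : consSeq x s (n + 1) = s n := rfl

theorem consSeq_head_tail (u : ℕ → ℕ) : consSeq (u 0) (fun n => u (n + 1)) = u := by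
  funext n
  cases n <;> rfl

/-- A `{0,1}`-sequence vanishing from position `M` on. -/
def IsBinaryBelow (M : ℕ) (u : ℕ → ℕ) : Prop :=
  (∀ j, u j ≤ 1) ∧ ∀ j, M ≤ j → u j = 0

theorem IsBinaryBelow.cons {M x : ℕ} {s : ℕ → ℕ} (h : IsBinaryBelow M s) (hx : x ≤ 1) :
    IsBinaryBelow (M + 1) (consSeq x s) := by
  refine ⟨fun j => ?_, fun j hj => ?_⟩
  · cases j with
    | zero => exact hx
    | succ j => exact h.1 j
  · cases j with
    | zero => omega
    | succ j => exact h.2 j (by omega)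

theorem IsBinaryBelow.of_cons {M x : ℕ} {s : ℕ → ℕ} (h : IsBinaryBelow (M + 1) (consSeq x s)) :
    IsBinaryBelow M s :=
  ⟨fun j => h.1 (j + 1), fun j hj => h.2 (j + 1) (by omega)⟩

/-- Induction on `{0,1}`-sequences with finitely many `1`s, with access to the tails of
length one and two. -/
theorem IsBinaryBelow.induct {motive : (ℕ → ℕ) → Prop}
    (zero : motive 0)
    (cons_zero : ∀ M s, IsBinaryBelow M s → motive s → motive (consSeq 0 s))
    (cons_one_zero : ∀ M s, IsBinaryBelow M s → motive s → motive (consSeq 0 s) →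
      motive (consSeq 1 (consSeq 0 s)))
    (cons_one_one : ∀ M s, IsBinaryBelow M s → motive s → motive (consSeq 1 s) →
      motive (consSeq 1 (consSeq 1 s)))
    {M : ℕ} {u : ℕ → ℕ} (h : IsBinaryBelow M u) : motive u := by
  have key : ∀ M, (∀ u, IsBinaryBelow M u → motive u) ∧
      ∀ u, IsBinaryBelow (M + 1) u → motive u := by
    intro M
    induction M with
    | zero =>
      have h0 : ∀ u, IsBinaryBelow 0 u → motive u := fun u hu => by
        rwa [show u = 0 from funext fun j => hu.2 j (Nat.zero_le j)]
      refine ⟨h0, fun u hu => ?_⟩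
      rw [← consSeq_head_tail u] at hu ⊢
      have hs := hu.of_cons
      have hx := hu.1 0
      generalize (fun n => u (n + 1)) = s at *
      generalize u 0 = x at *
      simp only [consSeq_zero] at hx
      interval_cases x
      · exact cons_zero _ _ hs (h0 _ hs)
      · have h00 : (0 : ℕ → ℕ) = consSeq 0 0 := by
          funext j
          cases j <;> rfl
        rw [show s = 0 from funext fun j => hs.2 j (Nat.zero_le j), h00]
        exact cons_one_zero 0 0 ⟨fun _ => Nat.zero_le _, fun _ _ => rfl⟩ zero (h00 ▸ zero)
    | succ M ih =>
      refine ⟨ih.2, fun u hu => ?_⟩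
      rw [← consSeq_head_tail u] at hu ⊢
      have hs := hu.of_cons
      have hx := hu.1 0
      generalize (fun n => u (n + 1)) = s at *
      generalize u 0 = x at *
      simp only [consSeq_zero] at hx
      interval_cases x
      · exact cons_zero _ _ hs (ih.2 _ hs)
      · have hms := ih.2 _ hs
        rw [← consSeq_head_tail s] at hs hms ⊢
        have hs' := hs.of_cons
        have hy := hs.1 0
        generalize (fun n => s (n + 1)) = t at *
        generalize s 0 = y at *
        simp only [consSeq_zero] at hy
        interval_cases y
        · exact cons_one_zero _ _ hs' (ih.1 _ hs') hms
        · exact cons_one_one _ _ hs' (ih.1 _ hs') hms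
  exact (key M).1 u h

/-! ### The 01-elimination, entry by entry -/

theorem infinite_not_removed01 {M : ℕ} {u : ℕ → ℕ} (h : IsBinaryBelow M u) :
    (Set.ofPred fun i => ¬ removed01 u i).Infinite := by
  refine Set.infinite_of_injective_forall_mem (f := fun i => M + 1 + i)
    (fun i j hij => by simpa using hij) fun i => ?_
  have h1 := h.2 (M + 1 + i) (by omega)
  have h2 := h.2 (M + 1 + i + 1) (by omega)
  have h3 := h.2 (M + 1 + i - 1) (by omega)
  simp [removed01, h1, h2]

theorem nth_eq_of_strictMono {p : ℕ → Prop} {f : ℕ → ℕ} (hf : StrictMono f)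
    (hp : ∀ x, p x ↔ ∃ n, f n = x) : Nat.nth p = f := by
  have hr : Set.ofPred p = Set.range f := Set.ext hp
  have hinf : (Set.ofPred p).Infinite := hr ▸ Set.infinite_range_of_injective hf.injective
  rw [← (Nat.nth_strictMono hinf).range_inj hf, Nat.range_nth_of_infinite hinf, hr]

theorem exists_nth_iff {p : ℕ → Prop} (hp : (Set.ofPred p).Infinite) (x : ℕ) :
    p x ↔ ∃ n, Nat.nth p n = x := by
  have := Nat.range_nth_of_infinite hp
  exact ⟨fun h => this.ge h, fun h => this.le h⟩

theorem removed01_consSeq {x : ℕ} {s : ℕ → ℕ} (hx : ¬ x < s 0) (i : ℕ) :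
    removed01 (consSeq x s) (i + 1) ↔ removed01 s i := by
  cases i with
  | zero => simp [removed01, hx]
  | succ i => simp [removed01]

theorem elim01_consSeq {M x : ℕ} {s : ℕ → ℕ} (hs : IsBinaryBelow M s) (hx : ¬ x < s 0) :
    elim01 (consSeq x s) = consSeq x (elim01 s) := by
  have hinf := infinite_not_removed01 hs
  have hn : Nat.nth (fun i => ¬ removed01 (consSeq x s) i) =
      consSeq 0 (fun n => Nat.nth (fun i => ¬ removed01 s i) n + 1) := by
    refine nth_eq_of_strictMono (strictMono_nat_of_lt_succ fun n => ?_) fun y => ?_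
    · cases n with
      | zero => simp
      | succ n => simpa using Nat.nth_strictMono hinf (Nat.lt_succ_self n)
    · cases y with
      | zero => exact ⟨fun _ => ⟨0, rfl⟩, fun _ => by simpa [removed01] using hx⟩
      | succ y =>
        rw [removed01_consSeq hx, exists_nth_iff hinf]
        constructor
        · rintro ⟨n, rfl⟩
          exact ⟨n + 1, rfl⟩
        · rintro ⟨_ | n, h⟩
          · simp at h
          · exact ⟨n, by simpa using h⟩
  funext n
  simp only [elim01, hn]
  cases n <;> simp [elim01]

theorem elim01_zero_one {M : ℕ} {s : ℕ → ℕ} (hs : IsBinaryBelow M s) :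
    elim01 (consSeq 0 (consSeq 1 s)) = elim01 s := by
  have hinf := infinite_not_removed01 hs
  have hs0 : ¬ 1 < s 0 := not_lt.2 (hs.1 0)
  have hn : Nat.nth (fun i => ¬ removed01 (consSeq 0 (consSeq 1 s)) i) =
      fun n => Nat.nth (fun i => ¬ removed01 s i) n + 2 := by
    refine nth_eq_of_strictMono (fun m n hmn => by simpa using Nat.nth_strictMono hinf hmn)
      fun y => ?_
    match y with
    | 0 => simp [removed01]
    | 1 => simp [removed01]
    | y + 2 =>
      have : removed01 (consSeq 0 (consSeq 1 s)) (y + 2) ↔ removed01 (consSeq 1 s) (y + 1) := by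
        simp [removed01]
      rw [this, removed01_consSeq hs0, exists_nth_iff hinf]
      simp
  funext n
  simp only [elim01, hn]
  rfl

theorem IsBinaryBelow.elim01 {M : ℕ} {u : ℕ → ℕ} (h : IsBinaryBelow M u) :
    IsBinaryBelow M (elim01 u) :=
  ⟨fun _ => h.1 _, fun _ hj => h.2 _
    (hj.trans ((Nat.nth_strictMono (infinite_not_removed01 h)).id_le _))⟩

theorem consSeq_zero_zero : consSeq 0 0 = 0 := by
  funext j
  cases j <;> rfl

theorem isBinaryBelow_zero : IsBinaryBelow 0 0 :=
  ⟨fun _ => Nat.zero_le _, fun _ _ => rfl⟩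

theorem elim01_zero : elim01 0 = 0 :=
  funext fun _ => rfl

/-! ### The box-ball evolution with a nonempty initial carrier -/

/-- The carrier of unbounded capacity with initial load `c`. -/
def carFrom (c : ℕ) (u : ℕ → ℕ) : ℕ → ℕ
  | 0 => c
  | j + 1 => carFrom c u j - min (carFrom c u j) (1 - u j) + u j

/-- The box-ball evolution with initial carrier load `c`. -/
def bbsFrom (c : ℕ) (u : ℕ → ℕ) : ℕ → ℕ := fun j => min (carFrom c u j) (1 - u j)

theorem bbsFrom_zero (u : ℕ → ℕ) : bbsFrom 0 u = bbsT u := by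
  have : ∀ j, carFrom 0 u j = car u j := fun j => by
    induction j with
    | zero => rfl
    | succ j ih => simp [carFrom, car, ih]
  funext j
  simp [bbsFrom, bbsT, this]

theorem bbsFrom_consSeq (c x : ℕ) (s : ℕ → ℕ) :
    bbsFrom c (consSeq x s) = consSeq (min c (1 - x)) (bbsFrom (c - min c (1 - x) + x) s) := by
  have : ∀ j, carFrom c (consSeq x s) (j + 1) = carFrom (c - min c (1 - x) + x) s j := fun j => by
    induction j with
    | zero => rfl
    | succ j ih => rw [carFrom, ih]; rfl
  funext j
  cases j with
  | zero => rfl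
  | succ j => simp [bbsFrom, this]

theorem bbsFrom_cons_one (c : ℕ) (s : ℕ → ℕ) :
    bbsFrom c (consSeq 1 s) = consSeq 0 (bbsFrom (c + 1) s) := by
  simp [bbsFrom_consSeq]

theorem bbsFrom_succ_cons_zero (c : ℕ) (s : ℕ → ℕ) :
    bbsFrom (c + 1) (consSeq 0 s) = consSeq 1 (bbsFrom c s) := by
  simp [bbsFrom_consSeq]

theorem bbsFrom_zero_cons_zero (s : ℕ → ℕ) :
    bbsFrom 0 (consSeq 0 s) = consSeq 0 (bbsFrom 0 s) := by
  simp [bbsFrom_consSeq]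

theorem bbsFrom_zero_zero (s : ℕ → ℕ) : bbsFrom 0 s 0 = 0 := by
  simp [bbsFrom, carFrom]

theorem bbsFrom_zero_fun : bbsFrom 0 0 = 0 := by
  have hc : ∀ j, carFrom 0 0 j = 0 := fun j => by
    induction j with
    | zero => rfl
    | succ j ih => simp [carFrom, ih]
  funext j
  simp [bbsFrom, hc]

theorem exists_isBinaryBelow_bbsFrom {M : ℕ} {u : ℕ → ℕ} (h : IsBinaryBelow M u) :
    ∀ c, ∃ M', IsBinaryBelow M' (bbsFrom c u) := by
  have hone : ∀ s, (∀ c, ∃ M', IsBinaryBelow M' (bbsFrom c s)) →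
      ∀ c, ∃ M', IsBinaryBelow M' (bbsFrom c (consSeq 1 s)) := fun s ih c => by
    obtain ⟨M', hM'⟩ := ih (c + 1)
    exact ⟨M' + 1, bbsFrom_cons_one c s ▸ hM'.cons zero_le_one⟩
  refine IsBinaryBelow.induct (motive := fun u => ∀ c, ∃ M', IsBinaryBelow M' (bbsFrom c u))
    ?_ ?_ ?_ ?_ h
  · intro c
    induction c with
    | zero => exact ⟨0, bbsFrom_zero_fun.symm ▸ isBinaryBelow_zero⟩
    | succ c ih =>
      obtain ⟨M', hM'⟩ := ih
      refine ⟨M' + 1, ?_⟩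
      rw [← consSeq_zero_zero, bbsFrom_succ_cons_zero]
      exact hM'.cons le_rfl
  · intro _ s _ ih c
    cases c with
    | zero =>
      obtain ⟨M', hM'⟩ := ih 0
      exact ⟨M' + 1, bbsFrom_zero_cons_zero s ▸ hM'.cons zero_le_one⟩
    | succ c =>
      obtain ⟨M', hM'⟩ := ih c
      exact ⟨M' + 1, bbsFrom_succ_cons_zero c s ▸ hM'.cons le_rfl⟩
  · exact fun _ s _ _ ih => hone _ ih
  · exact fun _ s _ _ ih => hone _ ih

/-- The 01-elimination intertwines the box-ball evolution with itself, up to a shift. -/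
theorem elim01_bbsFrom {M : ℕ} {u : ℕ → ℕ} (h : IsBinaryBelow M u) :
    ∀ c, elim01 (bbsFrom c u) = bbsFrom c (elim01 (consSeq 0 u)) := by
  have hzero : ∀ M s, IsBinaryBelow M s →
      (∀ c, elim01 (bbsFrom c s) = bbsFrom c (elim01 (consSeq 0 s))) →
      ∀ c, elim01 (bbsFrom c (consSeq 0 s)) =
        bbsFrom c (elim01 (consSeq 0 (consSeq 0 s))) := fun M s hs ih c => by
    rw [elim01_consSeq (hs.cons zero_le_one) (by simp)]
    cases c with
    | zero =>
      obtain ⟨M', hM'⟩ := exists_isBinaryBelow_bbsFrom hs 0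
      rw [bbsFrom_zero_cons_zero, bbsFrom_zero_cons_zero,
        elim01_consSeq hM' (by simp [bbsFrom_zero_zero]), ih]
    | succ c =>
      obtain ⟨M', hM'⟩ := exists_isBinaryBelow_bbsFrom hs c
      rw [bbsFrom_succ_cons_zero, bbsFrom_succ_cons_zero,
        elim01_consSeq hM' (not_lt.2 (hM'.1 0)), ih]
  refine IsBinaryBelow.induct
    (motive := fun u => ∀ c, elim01 (bbsFrom c u) = bbsFrom c (elim01 (consSeq 0 u)))
    ?_ hzero ?_ ?_ h
  · intro c
    rw [consSeq_zero_zero, elim01_zero]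
    induction c with
    | zero =>
      rw [bbsFrom_zero_fun, elim01_zero]
    | succ c ih =>
      obtain ⟨M', hM'⟩ := exists_isBinaryBelow_bbsFrom isBinaryBelow_zero c
      rw [← consSeq_zero_zero, bbsFrom_succ_cons_zero,
        elim01_consSeq hM' (not_lt.2 (hM'.1 0)), ih]
  · intro _ s hs ih _ c
    obtain ⟨M', hM'⟩ := exists_isBinaryBelow_bbsFrom hs c
    rw [bbsFrom_cons_one, bbsFrom_succ_cons_zero, elim01_zero_one hM', ih,
      elim01_zero_one (hs.cons zero_le_one)]
  · intro _ s hs _ ih c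
    obtain ⟨M', hM'⟩ := exists_isBinaryBelow_bbsFrom (hs.cons le_rfl) (c + 1)
    rw [bbsFrom_cons_one, elim01_consSeq hM' (by simp [bbsFrom_cons_one]), ih,
      elim01_zero_one hs, elim01_zero_one (hs.cons le_rfl),
      elim01_consSeq hs (not_lt.2 (hs.1 0)), bbsFrom_cons_one]

/-! ### The padded elimination -/

/-- The 01-elimination followed by a shift. It preserves vanishing at the origin. -/
noncomputable def padElim (u : ℕ → ℕ) : ℕ → ℕ := consSeq 0 (elim01 u)

theorem IsBinaryBelow.padElim {M : ℕ} {u : ℕ → ℕ} (h : IsBinaryBelow M u) :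
    IsBinaryBelow (M + 1) (padElim u) :=
  h.elim01.cons zero_le_one

theorem padElim_consSeq_zero {M : ℕ} {s : ℕ → ℕ} (hs : IsBinaryBelow M s) (h0 : s 0 = 0) :
    padElim (consSeq 0 s) = consSeq 0 (padElim s) := by
  rw [padElim, elim01_consSeq hs (by simp [h0]), padElim]

theorem padElim_bbsT {M : ℕ} {u : ℕ → ℕ} (h : IsBinaryBelow M u) (h0 : u 0 = 0) :
    padElim (bbsT u) = consSeq 0 (bbsT (padElim u)) := by
  rw [padElim, ← bbsFrom_zero, elim01_bbsFrom h, elim01_consSeq h (by simp [h0]), bbsFrom_zero,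
    padElim]

theorem finite_ascSet {M : ℕ} {u : ℕ → ℕ} (h : IsBinaryBelow M u) : (ascSet u).Finite :=
  (Set.finite_Iio M).subset fun j (hj : u j < u (j + 1)) => by
    by_contra hc
    simp only [Set.mem_Iio, not_lt] at hc
    have := h.2 (j + 1) (by omega)
    omega

theorem ascN_consSeq {M : ℕ} {s : ℕ → ℕ} (hs : IsBinaryBelow M s) (x : ℕ) :
    ascN (consSeq x s) = (if x < s 0 then 1 else 0) + ascN s := by
  have hN : (Nat.succ '' ascSet s).ncard = ascN s :=
    Set.ncard_image_of_injective _ Nat.succ_injective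
  have hfin := (finite_ascSet hs).image Nat.succ
  have hmem : ∀ j, j + 1 ∈ ascSet (consSeq x s) ↔ j ∈ ascSet s := fun j => Iff.rfl
  split_ifs with hx
  · have : ascSet (consSeq x s) = insert 0 (Nat.succ '' ascSet s) := by
      ext j
      cases j with
      | zero => simpa [ascSet] using hx
      | succ j => simp [hmem]
    rw [ascN, this, Set.ncard_insert_of_notMem (by simp) hfin, hN, add_comm]
  · have : ascSet (consSeq x s) = Nat.succ '' ascSet s := by
      ext j
      cases j with
      | zero => simpa [ascSet] using hx
      | succ j => simp [hmem]
    rw [ascN, this, hN, zero_add]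

theorem ascN_padElim_iterate_consSeq_zero (m : ℕ) : ∀ {M : ℕ} {s : ℕ → ℕ},
    IsBinaryBelow M s → s 0 = 0 →
      ascN (padElim^[m] (consSeq 0 s)) = ascN (padElim^[m] s) := by
  induction m with
  | zero =>
    intro M s hs h0
    simp [ascN_consSeq hs, h0]
  | succ m ih =>
    intro M s hs h0
    rw [Function.iterate_succ_apply, Function.iterate_succ_apply, padElim_consSeq_zero hs h0,
      ih hs.padElim rfl]

theorem exists_isBinaryBelow_bbsT {M : ℕ} {u : ℕ → ℕ} (h : IsBinaryBelow M u) :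
    ∃ M', IsBinaryBelow M' (bbsT u) :=
  bbsFrom_zero u ▸ exists_isBinaryBelow_bbsFrom h 0

theorem bbsT_zero (u : ℕ → ℕ) : bbsT u 0 = 0 := by
  simp [bbsT, car]

/-! ### Lattice words -/

/-- Every prefix contains at most `b` more `1`s than `0`s. -/
def IsBallot (b : ℕ) (u : ℕ → ℕ) : Prop :=
  ∀ k, 2 * ∑ j ∈ Finset.range k, u j ≤ b + k

theorem isBallot_consSeq {b x : ℕ} {s : ℕ → ℕ} :
    IsBallot b (consSeq x s) ↔ ∀ k, 2 * (x + ∑ j ∈ Finset.range k, s j) ≤ b + (k + 1) := by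
  constructor
  · intro h k
    simpa [Finset.sum_range_succ', add_comm] using h (k + 1)
  · intro h k
    cases k with
    | zero => simp
    | succ k => simpa [Finset.sum_range_succ', add_comm] using h k

theorem isBallot_cons_zero {b : ℕ} {s : ℕ → ℕ} :
    IsBallot b (consSeq 0 s) ↔ IsBallot (b + 1) s := by
  rw [isBallot_consSeq]
  exact forall_congr' fun k => by omega

theorem isBallot_cons_one {b : ℕ} {s : ℕ → ℕ} :
    IsBallot (b + 1) (consSeq 1 s) ↔ IsBallot b s := by
  rw [isBallot_consSeq]
  exact forall_congr' fun k => by omega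

theorem not_isBallot_cons_one {s : ℕ → ℕ} : ¬ IsBallot 0 (consSeq 1 s) := fun h => by
  simpa using h 1

theorem IsBallot.elim01 {M : ℕ} {u : ℕ → ℕ} (h : IsBinaryBelow M u) :
    ∀ b, IsBallot b u → IsBallot b (elim01 u) := by
  have key : ∀ u, IsBinaryBelow M u → (∀ b, IsBallot b u → IsBallot b (_root_.elim01 u)) ∧
      ∀ b, IsBallot b (consSeq 0 u) → IsBallot b (_root_.elim01 (consSeq 0 u)) := by
    intro u hu
    refine IsBinaryBelow.induct
      (motive := fun u => (∀ b, IsBallot b u → IsBallot b (_root_.elim01 u)) ∧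
        ∀ b, IsBallot b (consSeq 0 u) → IsBallot b (_root_.elim01 (consSeq 0 u)))
      ?_ ?_ ?_ ?_ hu
    · rw [consSeq_zero_zero, elim01_zero]
      exact ⟨fun _ hb => hb, fun _ hb => hb⟩
    · intro _ s hs ih
      refine ⟨ih.2, fun b hb => ?_⟩
      rw [elim01_consSeq (hs.cons zero_le_one) (by simp), isBallot_cons_zero]
      exact ih.2 _ (isBallot_cons_zero.1 hb)
    · intro _ s hs ih ih'
      have hs' := hs.cons zero_le_one
      refine ⟨fun b hb => ?_, fun b hb => ?_⟩
      · rw [elim01_consSeq hs' (by simp)]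
        obtain _ | b := b
        · exact absurd hb not_isBallot_cons_one
        · exact isBallot_cons_one.2 (ih'.1 _ (isBallot_cons_one.1 hb))
      · rw [elim01_zero_one hs']
        exact ih'.1 _ (isBallot_cons_one.1 (isBallot_cons_zero.1 hb))
    · intro _ s hs ih ih'
      have hs' := hs.cons le_rfl
      refine ⟨fun b hb => ?_, fun b hb => ?_⟩
      · rw [elim01_consSeq hs' (by simp)]
        obtain _ | b := b
        · exact absurd hb not_isBallot_cons_one
        · exact isBallot_cons_one.2 (ih'.1 _ (isBallot_cons_one.1 hb))
      · rw [elim01_zero_one hs']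
        exact ih'.1 _ (isBallot_cons_one.1 (isBallot_cons_zero.1 hb))
  exact (key u h).1

theorem ascN_padElim_iterate_of_isBallot (m : ℕ) : ∀ {M : ℕ} {u : ℕ → ℕ},
    IsBinaryBelow M u → IsBallot 0 u → ascN (padElim^[m] u) = ascN (elim01^[m] u) := by
  induction m with
  | zero => simp
  | succ m ih =>
    intro M u hu hb
    have hb' := IsBallot.elim01 hu 0 hb
    have h0 : elim01 u 0 = 0 := by
      have := hb' 1
      simp only [Finset.range_one, Finset.sum_singleton] at this
      omega
    rw [Function.iterate_succ_apply, Function.iterate_succ_apply, padElim,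
      ascN_padElim_iterate_consSeq_zero m hu.elim01 h0, ih hu.elim01 hb']

theorem IsState.exists_isBinaryBelow {u : ℕ → ℕ} (hu : IsState u) :
    ∃ M, IsBinaryBelow M u := by
  obtain ⟨M, hM⟩ := hu.2.2.bddAbove
  refine ⟨M + 1, hu.2.1, fun j hj => ?_⟩
  by_contra hne
  have := hM (show u j = 1 from le_antisymm (hu.2.1 j) (Nat.one_le_iff_ne_zero.2 hne))
  omega

theorem IsLattice.isBallot {u : ℕ → ℕ} (hu : IsLattice u) : IsBallot 0 u := by
  intro k
  obtain _ | k := k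
  · simp
  have hone : {j | j ≤ k ∧ u j = 1}.ncard = ∑ j ∈ Finset.range (k + 1), u j := by
    have : {j | j ≤ k ∧ u j = 1} = ↑((Finset.range (k + 1)).filter fun j => u j = 1) := by
      ext j
      simp
    rw [this, Set.ncard_coe_finset, Finset.card_filter]
    refine Finset.sum_congr rfl fun j _ => ?_
    have := hu.1.2.1 j
    split_ifs <;> omega
  have hzero : {j | j ≤ k ∧ u j = 0}.ncard = ∑ j ∈ Finset.range (k + 1), (1 - u j) := by
    have : {j | j ≤ k ∧ u j = 0} = ↑((Finset.range (k + 1)).filter fun j => u j = 0) := by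
      ext j
      simp
    rw [this, Set.ncard_coe_finset, Finset.card_filter]
    refine Finset.sum_congr rfl fun j _ => ?_
    have := hu.1.2.1 j
    split_ifs <;> omega
  have hsum : ∑ j ∈ Finset.range (k + 1), u j + ∑ j ∈ Finset.range (k + 1), (1 - u j) = k + 1 := by
    rw [← Finset.sum_add_distrib]
    calc _ = ∑ j ∈ Finset.range (k + 1), 1 :=
          Finset.sum_congr rfl fun j _ => by have := hu.1.2.1 j; omega
      _ = k + 1 := by simp
  have := hu.2 k
  omega

/-! ### Elimination of separated blocks -/

theorem IsBinaryBelow.cons_iterate {M x : ℕ} {s : ℕ → ℕ} (hs : IsBinaryBelow M s) (hx : x ≤ 1)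
    (n : ℕ) : IsBinaryBelow (M + n) ((consSeq x)^[n] s) := by
  induction n with
  | zero => exact hs
  | succ n ih =>
    rw [Function.iterate_succ_apply']
    exact ih.cons hx

theorem consSeq_zero_iterate_zero {s : ℕ → ℕ} (h0 : s 0 = 0) (n : ℕ) :
    (consSeq 0)^[n] s 0 = 0 := by
  cases n with
  | zero => exact h0
  | succ n => rw [Function.iterate_succ_apply']; rfl

theorem elim01_cons_one_iterate {M : ℕ} {s : ℕ → ℕ} (hs : IsBinaryBelow M s) (n : ℕ) :
    elim01 ((consSeq 1)^[n] s) = (consSeq 1)^[n] (elim01 s) := by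
  induction n with
  | zero => rfl
  | succ n ih =>
    have hn := hs.cons_iterate le_rfl n
    rw [Function.iterate_succ_apply', elim01_consSeq hn (not_lt.2 (hn.1 0)), ih,
      Function.iterate_succ_apply']

theorem elim01_cons_zero_iterate {M : ℕ} {s : ℕ → ℕ} (hs : IsBinaryBelow M s) (h0 : s 0 = 0)
    (n : ℕ) : elim01 ((consSeq 0)^[n] s) = (consSeq 0)^[n] (elim01 s) := by
  induction n with
  | zero => rfl
  | succ n ih =>
    rw [Function.iterate_succ_apply', elim01_consSeq (hs.cons_iterate zero_le_one n)
      (by simp [consSeq_zero_iterate_zero h0]), ih, Function.iterate_succ_apply']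

/-- The word `0 1^q 0^(q-1)` followed by `s`; for `q = 0` this is just `s`. -/
def block : ℕ → (ℕ → ℕ) → ℕ → ℕ
  | 0, s => s
  | q + 1, s => consSeq 0 ((consSeq 1)^[q + 1] ((consSeq 0)^[q] s))

theorem block_zero_eq {s : ℕ → ℕ} (h0 : s 0 = 0) (q : ℕ) : block q s 0 = 0 := by
  cases q with
  | zero => exact h0
  | succ q => rfl

theorem IsBinaryBelow.block {M : ℕ} {s : ℕ → ℕ} (hs : IsBinaryBelow M s) (q : ℕ) :
    ∃ M', IsBinaryBelow M' (block q s) := by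
  cases q with
  | zero => exact ⟨M, hs⟩
  | succ q =>
    exact ⟨_, ((hs.cons_iterate zero_le_one q).cons_iterate le_rfl (q + 1)).cons zero_le_one⟩

theorem padElim_block {M : ℕ} {s : ℕ → ℕ} (hs : IsBinaryBelow M s) (h0 : s 0 = 0) (q : ℕ) :
    padElim (block q s) = block (q - 1) (padElim s) := by
  cases q with
  | zero => rfl
  | succ q =>
    have hz := hs.cons_iterate zero_le_one q
    rw [block, Function.iterate_succ_apply', padElim, elim01_zero_one (hz.cons_iterate le_rfl q),
      elim01_cons_one_iterate hz, elim01_cons_zero_iterate hs h0, Nat.add_sub_cancel]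
    cases q with
    | zero => rfl
    | succ q => rw [block, padElim, Function.iterate_succ_apply (consSeq 0)]

theorem padElim_cons_zero_iterate {M : ℕ} {s : ℕ → ℕ} (hs : IsBinaryBelow M s) (h0 : s 0 = 0)
    (n : ℕ) : padElim ((consSeq 0)^[n] s) = (consSeq 0)^[n] (padElim s) := by
  rw [padElim, elim01_cons_zero_iterate hs h0, padElim, ← Function.iterate_succ_apply' (consSeq 0),
    ← Function.iterate_succ_apply (consSeq 0)]

theorem ascN_cons_zero_iterate {M : ℕ} {s : ℕ → ℕ} (hs : IsBinaryBelow M s) (h0 : s 0 = 0)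
    (n : ℕ) : ascN ((consSeq 0)^[n] s) = ascN s := by
  induction n with
  | zero => rfl
  | succ n ih =>
    rw [Function.iterate_succ_apply', ascN_consSeq (hs.cons_iterate zero_le_one n), ih]
    simp [consSeq_zero_iterate_zero h0]

theorem ascN_cons_one_iterate {M : ℕ} {s : ℕ → ℕ} (hs : IsBinaryBelow M s) (n : ℕ) :
    ascN ((consSeq 1)^[n] s) = ascN s := by
  induction n with
  | zero => rfl
  | succ n ih =>
    have hn := hs.cons_iterate le_rfl n
    rw [Function.iterate_succ_apply', ascN_consSeq hn, ih]
    simp [hn.1 0]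

theorem ascN_block {M : ℕ} {s : ℕ → ℕ} (hs : IsBinaryBelow M s) (h0 : s 0 = 0) (q : ℕ) :
    ascN (block q s) = (if 0 < q then 1 else 0) + ascN s := by
  cases q with
  | zero => simp [block]
  | succ q =>
    have hz := hs.cons_iterate zero_le_one q
    rw [block, ascN_consSeq (hz.cons_iterate le_rfl (q + 1)), ascN_cons_one_iterate hz,
      ascN_cons_zero_iterate hs h0]
    simp [Function.iterate_succ_apply']

theorem ascN_padElim_iterate_block (m : ℕ) : ∀ {M : ℕ} {s : ℕ → ℕ} (p q : ℕ),
    IsBinaryBelow M s → s 0 = 0 →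
      ascN (padElim^[m] ((consSeq 0)^[p] (block q s))) =
        (if m < q then 1 else 0) + ascN (padElim^[m] s) := by
  induction m with
  | zero =>
    intro M s p q hs h0
    obtain ⟨M', hM'⟩ := hs.block q
    simp [ascN_cons_zero_iterate hM' (block_zero_eq h0 q), ascN_block hs h0]
  | succ m ih =>
    intro M s p q hs h0
    obtain ⟨M', hM'⟩ := hs.block q
    rw [Function.iterate_succ_apply, Function.iterate_succ_apply,
      padElim_cons_zero_iterate hM' (block_zero_eq h0 q), padElim_block hs h0,
      ih p (q - 1) hs.padElim rfl]
    simp only [Nat.lt_sub_iff_add_lt]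

/-! ### Runs of balls -/

/-- The `1`s of `u` form `N` maximal runs, the `i`-th from the left occupying the positions
`a i + 1, …, d i`. -/
structure HasRuns (N : ℕ) (a d : ℕ → ℕ) (u : ℕ → ℕ) : Prop where
  lt : ∀ i < N, a i < d i
  gap : ∀ i, i + 1 < N → d i < a (i + 1)
  le_one : ∀ x, u x ≤ 1
  eq_one_iff : ∀ x, u x = 1 ↔ ∃ i < N, a i < x ∧ x ≤ d i

theorem exists_hasRuns (M : ℕ) : ∀ u : ℕ → ℕ, IsBinaryBelow M u → u 0 = 0 →
    ∃ N a d, HasRuns N a d u ∧ ∀ i < N, d i < M := by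
  induction M with
  | zero =>
    intro u hu _
    exact ⟨0, 0, 0, ⟨by simp, by simp, hu.1, fun x => by simp [hu.2 x (Nat.zero_le x)]⟩, by simp⟩
  | succ M ih =>
    intro u hu h0
    have hM : IsBinaryBelow M (Function.update u M 0) := by
      refine ⟨fun j => ?_, fun j hj => ?_⟩ <;> by_cases h : j = M
      · simp [h]
      · simpa [h] using hu.1 j
      · simp [h]
      · simpa [h] using hu.2 j (by omega)
    obtain ⟨N, a, d, hr, hd⟩ := ih _ hM (by by_cases h : 0 = M <;> simp [Function.update, h, h0])
    have hval : ∀ x, x ≠ M → (u x = 1 ↔ ∃ i < N, a i < x ∧ x ≤ d i) := fun x hx => by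
      simpa [Function.update, hx] using hr.eq_one_iff x
    have hu1 := hu.1 M
    rcases (show u M = 0 ∨ u M = 1 by omega) with hz | ho
    · refine ⟨N, a, d, ⟨hr.lt, hr.gap, hu.1, fun x => ?_⟩, fun i hi => (hd i hi).trans (by omega)⟩
      by_cases hx : x = M
      · subst hx
        simp only [hz, zero_ne_one, false_iff, not_exists, not_and]
        intro i hi _
        have := hd i hi
        omega
      · exact hval x hx
    have hMpos : M ≠ 0 := by
      rintro rfl
      omega
    by_cases hl : ∃ n, N = n + 1 ∧ d n = M - 1
    · obtain ⟨n, rfl, hn⟩ := hl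
      have hlt := hr.lt n (by omega)
      refine ⟨n + 1, a, Function.update d n M, ⟨fun i hi => ?_, fun i hi => ?_, hu.1, fun x => ?_⟩,
        fun i hi => ?_⟩
      · have := hr.lt i hi
        by_cases h : i = n
        · subst h
          simp only [Function.update_self]
          omega
        · simpa [h] using this
      · simpa [show i ≠ n by omega] using hr.gap i hi
      · by_cases hx : x = M
        · subst hx
          simp only [ho, true_iff]
          exact ⟨n, by omega, by omega, by simp⟩
        · rw [hval x hx]
          refine exists_congr fun i => and_congr_right fun _ => and_congr_right fun _ => ?_
          by_cases h : i = n
          · subst h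
            simp only [Function.update_self]
            omega
          · simp [h]
      · have := hd i hi
        by_cases h : i = n
        · simp [h]
        · simp only [ne_eq, h, not_false_eq_true, Function.update_of_ne]
          omega
    · push Not at hl
      refine ⟨N + 1, Function.update a N (M - 1), Function.update d N M,
        ⟨fun i hi => ?_, fun i hi => ?_, hu.1, fun x => ?_⟩, fun i hi => ?_⟩
      · by_cases h : i = N
        · subst h
          simp only [Function.update_self]
          omega
        · simpa [h] using hr.lt i (by omega)
      · by_cases h : i + 1 = N
        · have h1 := hl i h.symm
          have h2 := hd i (by omega)
          simp only [h, Function.update_self, ne_eq, show i ≠ N by omega, not_false_eq_true,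
            Function.update_of_ne]
          omega
        · simpa [h, show i ≠ N by omega] using hr.gap i (by omega)
      · by_cases hx : x = M
        · subst hx
          simp only [ho, true_iff]
          refine ⟨N, by omega, ?_, ?_⟩ <;> simp only [Function.update_self] <;> omega
        · rw [hval x hx]
          constructor
          · rintro ⟨i, hi, h⟩
            exact ⟨i, by omega, by simpa [show i ≠ N by omega] using h⟩
          · rintro ⟨i, hi, h⟩
            by_cases hiN : i = N
            · subst hiN
              simp only [Function.update_self] at h
              omega
            · exact ⟨i, by omega, by simpa [hiN] using h⟩
      · by_cases h : i = N
        · simp [h]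
        · have := hd i (by omega)
          simp only [ne_eq, h, not_false_eq_true, Function.update_of_ne]
          omega

namespace HasRuns

variable {N : ℕ} {a d u : ℕ → ℕ}

theorem gap_of_lt (h : HasRuns N a d u) {i j : ℕ} (hij : i < j) (hj : j < N) : d i < a j := by
  obtain ⟨k, rfl⟩ : ∃ k, j = i + 1 + k := ⟨j - (i + 1), by omega⟩
  clear hij
  induction k with
  | zero => exact h.gap i hj
  | succ k ih =>
    have h1 := ih (by omega)
    have h2 := h.lt (i + 1 + k) (by omega)
    have h3 := h.gap (i + 1 + k) (by omega)
    simp only [← add_assoc]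
    omega

theorem left_lt (h : HasRuns N a d u) {i j : ℕ} (hij : i < j) (hj : j < N) : a i < a j :=
  (h.lt i (hij.trans hj)).trans (h.gap_of_lt hij hj)

theorem right_lt (h : HasRuns N a d u) {i j : ℕ} (hij : i < j) (hj : j < N) : d i < d j :=
  (h.gap_of_lt hij hj).trans (h.lt j hj)

theorem eq_zero (h : HasRuns N a d u) {x : ℕ} (hx : ∀ i < N, a i < x → d i < x) : u x = 0 := by
  have h1 := h.le_one x
  have h2 : u x ≠ 1 := fun hc => by
    obtain ⟨i, hi, h3, h4⟩ := (h.eq_one_iff x).1 hc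
    have := hx i hi h3
    omega
  omega

theorem eq_zero_of_gap (h : HasRuns N a d u) {i x : ℕ} (hi : i < N) (hx : d i < x)
    (hx' : i + 1 < N → x ≤ a (i + 1)) : u x = 0 := by
  refine h.eq_zero fun j hj haj => ?_
  rcases lt_trichotomy j i with hji | rfl | hji
  · exact (h.right_lt hji hi).trans hx
  · exact hx
  · have h1 := hx' (by omega)
    rcases Nat.eq_or_lt_of_le (Nat.succ_le_of_lt hji) with h2 | h2
    · rw [← h2] at haj
      exact absurd haj (by simpa using h1)
    · have := h.left_lt h2 hj
      simp only [Nat.succ_eq_add_one] at this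
      omega

theorem eq_zero_of_le_left (h : HasRuns N a d u) {i x : ℕ} (hi : i < N) (hx : x ≤ a i)
    (hx' : ∀ j, j + 1 = i → d j < x) : u x = 0 := by
  cases i with
  | zero =>
    refine h.eq_zero fun j hj haj => ?_
    rcases Nat.eq_zero_or_pos j with rfl | hj0
    · omega
    · have := h.left_lt hj0 hj
      omega
  | succ i => exact h.eq_zero_of_gap (by omega) (hx' i rfl) fun _ => hx

theorem ascSet_eq (h : HasRuns N a d u) : ascSet u = {x | ∃ i < N, a i = x} := by
  ext x
  have hx1 := h.le_one x
  have hx2 := h.le_one (x + 1)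
  constructor
  · intro (hx : u x < u (x + 1))
    obtain ⟨i, hi, h1, h2⟩ := (h.eq_one_iff (x + 1)).1 (by omega)
    refine ⟨i, hi, ?_⟩
    by_contra hne
    have := (h.eq_one_iff x).2 ⟨i, hi, by omega, by omega⟩
    omega
  · rintro ⟨i, hi, rfl⟩
    have h1 := (h.eq_one_iff (a i + 1)).2 ⟨i, hi, by omega, h.lt i hi⟩
    have h2 := h.eq_zero_of_le_left hi le_rfl fun j hj => by
      subst hj
      exact h.gap j hi
    show u (a i) < u (a i + 1)
    omega

theorem descSet_eq (h : HasRuns N a d u) : descSet u = {x | ∃ i < N, d i = x} := by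
  ext x
  have hx1 := h.le_one x
  have hx2 := h.le_one (x + 1)
  constructor
  · intro (hx : u (x + 1) < u x)
    obtain ⟨i, hi, h1, h2⟩ := (h.eq_one_iff x).1 (by omega)
    refine ⟨i, hi, ?_⟩
    by_contra hne
    have := (h.eq_one_iff (x + 1)).2 ⟨i, hi, by omega, by omega⟩
    omega
  · rintro ⟨i, hi, rfl⟩
    have h1 := (h.eq_one_iff (d i)).2 ⟨i, hi, h.lt i hi, le_rfl⟩
    have h2 := h.eq_zero_of_gap hi (Nat.lt_succ_self _) fun hi' => h.gap i hi'
    show u (d i + 1) < u (d i)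
    simp only [Nat.succ_eq_add_one] at h2
    omega

theorem ascN_eq (h : HasRuns N a d u) : ascN u = N := by
  have : ascSet u = ↑((Finset.range N).image a) := by
    rw [h.ascSet_eq]
    ext x
    simp
  rw [ascN, this, Set.ncard_coe_finset, Finset.card_image_of_injOn, Finset.card_range]
  intro i hi j hj hij
  simp only [Finset.coe_range, Set.mem_Iio] at hi hj
  rcases lt_trichotomy i j with hlt | heq | hlt
  · have := h.left_lt hlt hj
    omega
  · exact heq
  · have := h.left_lt hlt hi
    omega

end HasRuns

/-! ### The evolution of the runs -/

/-- The carrier load after each run. -/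
def runCar (a d : ℕ → ℕ) : ℕ → ℕ
  | 0 => d 0 - a 0
  | i + 1 => runCar a d i - (a (i + 1) - d i) + (d (i + 1) - a (i + 1))

/-- The right ends of the runs after one step of the evolution. -/
def runStep (N : ℕ) (a d : ℕ → ℕ) (i : ℕ) : ℕ :=
  if i + 1 < N then d i + min (runCar a d i) (a (i + 1) - d i) else d i + runCar a d i

theorem car_add_of_zero {u : ℕ → ℕ} {y n : ℕ} (h : ∀ x, y ≤ x → x < y + n → u x = 0) :
    car u (y + n) = car u y - n := by
  induction n with
  | zero => rfl
  | succ n ih =>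
    have h1 := ih fun x hx hx' => h x hx (by omega)
    have h2 := h (y + n) (by omega) (by omega)
    rw [← add_assoc, car, h1, h2]
    omega

theorem car_add_of_one {u : ℕ → ℕ} {y n : ℕ} (h : ∀ x, y ≤ x → x < y + n → u x = 1) :
    car u (y + n) = car u y + n := by
  induction n with
  | zero => rfl
  | succ n ih =>
    have h1 := ih fun x hx hx' => h x hx (by omega)
    have h2 := h (y + n) (by omega) (by omega)
    rw [← add_assoc, car, h1, h2]
    omega

theorem exists_last_lt (a : ℕ → ℕ) (x N : ℕ) :
    (∀ i < N, x ≤ a i) ∨ ∃ i < N, a i < x ∧ (i + 1 < N → x ≤ a (i + 1)) := by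
  induction N with
  | zero => simp
  | succ n ih =>
    by_cases hn : a n < x
    · exact Or.inr ⟨n, by omega, hn, fun h => by omega⟩
    · rcases ih with h | ⟨i, hi, h1, h2⟩
      · refine Or.inl fun i hi => ?_
        rcases Nat.lt_succ_iff_lt_or_eq.1 hi with h3 | rfl
        · exact h i h3
        · omega
      · refine Or.inr ⟨i, by omega, h1, fun h3 => ?_⟩
        rcases Nat.lt_succ_iff_lt_or_eq.1 h3 with h4 | h4
        · exact h2 h4
        · rw [h4]
          omega

namespace HasRuns

variable {N : ℕ} {a d u : ℕ → ℕ}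

theorem car_eq_runCar (h : HasRuns N a d u) (i : ℕ) (hi : i < N) :
    car u (d i + 1) = runCar a d i := by
  have hrun : ∀ i < N, car u (d i + 1) = car u (a i + 1) + (d i - a i) := fun i hi => by
    have h0 := h.lt i hi
    have := car_add_of_one (u := u) (y := a i + 1) (n := d i - a i)
      fun x hx hx' => (h.eq_one_iff x).2 ⟨i, hi, by omega, by omega⟩
    rwa [show a i + 1 + (d i - a i) = d i + 1 by omega] at this
  rw [hrun i hi]
  induction i with
  | zero =>
    have := car_add_of_zero (u := u) (y := 0) (n := a 0 + 1)
      fun x _ hx => h.eq_zero_of_le_left hi (by omega) fun j hj => by omega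
    rw [zero_add] at this
    rw [this, show car u 0 = 0 from rfl, runCar]
    omega
  | succ i ih =>
    have h0 := h.gap i hi
    have := car_add_of_zero (u := u) (y := d i + 1) (n := a (i + 1) - d i)
      fun x hx hx' => h.eq_zero_of_gap (show i < N by omega) (by omega) fun _ => by omega
    rw [show d i + 1 + (a (i + 1) - d i) = a (i + 1) + 1 by omega] at this
    rw [this, hrun i (by omega), ih (by omega), runCar]

theorem car_of_gap (h : HasRuns N a d u) {i x : ℕ} (hi : i < N) (hx : d i < x)
    (hx' : i + 1 < N → x ≤ a (i + 1)) : car u x = runCar a d i - (x - d i - 1) := by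
  have := car_add_of_zero (u := u) (y := d i + 1) (n := x - d i - 1)
    fun y hy hy' => h.eq_zero_of_gap hi (by omega) fun hi' => by
      have := hx' hi'
      omega
  rwa [show d i + 1 + (x - d i - 1) = x by omega, h.car_eq_runCar i hi] at this

theorem le_runCar (a d : ℕ → ℕ) (i : ℕ) : d i - a i ≤ runCar a d i := by
  cases i with
  | zero => exact le_rfl
  | succ i => exact Nat.le_add_left _ _

theorem bbsT (h : HasRuns N a d u) : HasRuns N d (runStep N a d) (bbsT u) := by
  refine ⟨fun i hi => ?_, fun i hi => ?_, fun x => ?_, fun x => ?_⟩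
  · have h1 := h.lt i hi
    have h2 := le_runCar a d i
    unfold runStep
    split_ifs with h3
    · have := h.gap i h3
      omega
    · omega
  · have h1 := h.gap i hi
    have h2 := h.lt (i + 1) hi
    simp only [runStep, hi, if_true]
    omega
  · simp only [_root_.bbsT]
    omega
  · have hu1 := h.le_one x
    constructor
    · intro hx
      simp only [_root_.bbsT] at hx
      rcases exists_last_lt a x N with hl | ⟨i, hi, h1, h2⟩
      · have hz : ∀ y, 0 ≤ y → y < 0 + x → u y = 0 := fun y _ hy =>
          h.eq_zero fun i hi hay => by
            have := hl i hi
            omega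
        have := car_add_of_zero hz
        simp only [zero_add, car] at this
        omega
      · have hdx : d i < x := by
          by_contra hc
          have := (h.eq_one_iff x).2 ⟨i, hi, h1, by omega⟩
          omega
        have hc := h.car_of_gap hi hdx h2
        refine ⟨i, hi, hdx, ?_⟩
        unfold runStep
        split_ifs with h3
        · have := h2 h3
          omega
        · omega
    · rintro ⟨i, hi, h1, h2⟩
      have h3 : i + 1 < N → x ≤ a (i + 1) := fun hi' => by
        have := h.gap i hi'
        simp only [runStep, hi', if_true] at h2
        omega
      have h4 : x ≤ d i + runCar a d i := by
        unfold runStep at h2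
        split_ifs at h2 <;> omega
      have hc := h.car_of_gap hi h1 h3
      have hz := h.eq_zero_of_gap hi h1 h3
      simp only [_root_.bbsT]
      omega

end HasRuns

theorem ascN_bbsT {M : ℕ} {u : ℕ → ℕ} (hu : IsBinaryBelow M u) (h0 : u 0 = 0) :
    ascN (bbsT u) = ascN u := by
  obtain ⟨N, a, d, h, -⟩ := exists_hasRuns M u hu h0
  rw [h.ascN_eq, h.bbsT.ascN_eq]

theorem ascN_padElim_iterate_bbsT (m : ℕ) : ∀ {M : ℕ} {u : ℕ → ℕ},
    IsBinaryBelow M u → u 0 = 0 → ascN (padElim^[m] (bbsT u)) = ascN (padElim^[m] u) := by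
  induction m with
  | zero => exact fun hu h0 => ascN_bbsT hu h0
  | succ m ih =>
    intro M u hu h0
    obtain ⟨M', hM'⟩ := exists_isBinaryBelow_bbsT hu.padElim
    rw [Function.iterate_succ_apply, Function.iterate_succ_apply, padElim_bbsT hu h0,
      ascN_padElim_iterate_consSeq_zero m hM' (bbsT_zero _), ih hu.padElim rfl]

/-! ### Separated runs -/

theorem consSeq_iterate_apply (x : ℕ) (s : ℕ → ℕ) (n j : ℕ) :
    (consSeq x)^[n] s j = if j < n then x else s (j - n) := by
  induction n generalizing j with
  | zero => simp
  | succ n ih =>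
    rw [Function.iterate_succ_apply']
    cases j with
    | zero => simp
    | succ j => simp [ih]

theorem block_apply {s : ℕ → ℕ} {q : ℕ} (hq : 0 < q) (j : ℕ) :
    block q s j = if j = 0 then 0 else if j ≤ q then 1 else if j < 2 * q then 0
      else s (j - 2 * q) := by
  obtain ⟨q, rfl⟩ : ∃ r, q = r + 1 := ⟨q - 1, by omega⟩
  cases j with
  | zero => rfl
  | succ j =>
    rw [block, consSeq_succ, consSeq_iterate_apply, consSeq_iterate_apply]
    simp only [Nat.succ_ne_zero, if_false]
    split_ifs <;> first | rfl | omega | (congr 1; omega)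

theorem padElim_iterate_zero (m : ℕ) : padElim^[m] 0 = 0 := by
  induction m with
  | zero => rfl
  | succ m ih => rw [Function.iterate_succ_apply, padElim, elim01_zero, consSeq_zero_zero, ih]

/-- If each run is followed by a gap at least as long, the iterated elimination shortens all
runs at unit speed. -/
theorem HasRuns.ascN_padElim_iterate {N : ℕ} (m : ℕ) : ∀ {M : ℕ} {a d u : ℕ → ℕ},
    HasRuns N a d u → IsBinaryBelow M u → (∀ i, i + 1 < N → d i - a i ≤ a (i + 1) - d i) →
      ascN (padElim^[m] u) = ∑ i ∈ Finset.range N, if m < d i - a i then 1 else 0 := by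
  induction N with
  | zero =>
    intro M a d u h hu _
    rw [show u = 0 from funext fun x => h.eq_zero (by simp), padElim_iterate_zero]
    simp [ascN, ascSet]
  | succ N ih =>
    intro M a d u h hu hsep
    have h0 := h.lt 0 (by omega)
    set q := d 0 - a 0 with hq
    set s : ℕ → ℕ := fun x => u (x + (a 0 + 2 * q)) with hs
    have hsM : IsBinaryBelow M s := ⟨fun j => hu.1 _, fun j hj => hu.2 _ (by omega)⟩
    have hle : ∀ i, i < N → a 0 + 2 * q ≤ a (i + 1) := fun i hi => by
      have h1 := hsep 0 (by omega)
      have h2 := h.gap 0 (by omega)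
      rcases Nat.eq_zero_or_pos i with rfl | hi0
      · simp only [zero_add] at h1 h2 ⊢
        omega
      · have := h.left_lt (show 0 + 1 < i + 1 by omega) (by omega)
        simp only [zero_add] at h1 h2 this
        omega
    have hs0 : s 0 = 0 := h.eq_zero_of_gap (i := 0) (by omega) (by omega) fun h1 => by
      have := hle 0 (by omega)
      simpa using this
    have hru : HasRuns N (fun i => a (i + 1) - (a 0 + 2 * q))
        (fun i => d (i + 1) - (a 0 + 2 * q)) s := by
      refine ⟨fun i hi => ?_, fun i hi => ?_, fun x => hu.1 _, fun x => ?_⟩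
      · have h1 := h.lt (i + 1) (by omega)
        have h2 := hle i hi
        omega
      · have h1 := h.lt (i + 1) (by omega)
        have h2 := hle i (by omega)
        have h3 := h.gap (i + 1) (by omega)
        omega
      · rw [hs]
        simp only [h.eq_one_iff]
        constructor
        · rintro ⟨i, hi, h1, h2⟩
          obtain _ | i := i
          · omega
          · have h3 := hle i (by omega)
            exact ⟨i, by omega, by omega, by omega⟩
        · rintro ⟨i, hi, h1, h2⟩
          have h3 := hle i hi
          exact ⟨i + 1, by omega, by omega, by omega⟩
    have hdecomp : u = (consSeq 0)^[a 0] (block q s) := by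
      funext x
      rw [consSeq_iterate_apply, block_apply (by omega)]
      split_ifs with h1 h2 h3 h4
      · exact h.eq_zero_of_le_left (i := 0) (by omega) (by omega) fun j hj => by omega
      · exact h.eq_zero_of_le_left (i := 0) (by omega) (by omega) fun j hj => by omega
      · exact (h.eq_one_iff x).2 ⟨0, by omega, by omega, by omega⟩
      · refine h.eq_zero_of_gap (i := 0) (by omega) (by omega) fun h5 => ?_
        have := hle 0 (by omega)
        simp only [zero_add] at this ⊢
        omega
      · rw [hs]
        simp only
        congr 1
        omega
    rw [hdecomp, ascN_padElim_iterate_block m (a 0) q hsM hs0, ih hru hsM,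
      Finset.sum_range_succ', add_comm]
    · congr 1
      refine Finset.sum_congr rfl fun i hi => ?_
      rw [Finset.mem_range] at hi
      have h1 := hle i hi
      rw [show d (i + 1) - (a 0 + 2 * q) - (a (i + 1) - (a 0 + 2 * q)) = d (i + 1) - a (i + 1) by
        omega]
    · intro i hi
      have h1 := hle i (by omega)
      have h2 := hsep (i + 1) (by omega)
      have h3 := h.lt (i + 1) (by omega)
      omega

/-! ### Convergence of the ultradiscrete Toda lattice -/

theorem eventually_const_of_bounded {f : ℕ → ℕ} (B : ℕ) (hB : ∀ t, f t ≤ B) (K : ℕ)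
    (hf : ∀ t ≥ K, f t ≤ f (t + 1)) : ∃ K' ≥ K, ∀ t ≥ K', f (t + 1) = f t := by
  induction hn : B - f K using Nat.strong_induction_on generalizing K with
  | _ n ih =>
    by_cases hc : ∀ t ≥ K, f (t + 1) = f t
    · exact ⟨K, le_rfl, hc⟩
    · push Not at hc
      obtain ⟨t, ht, hne⟩ := hc
      have hmono : f K ≤ f t := by
        clear hne
        induction t, ht using Nat.le_induction with
        | base => exact le_rfl
        | succ t ht ih' => exact ih'.trans (hf t ht)
      have h1 := hf t ht
      have h2 := hB (t + 1)
      obtain ⟨K', hK', h3⟩ := ih (B - f (t + 1)) (by omega) (t + 1)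
        (fun s hs => hf s (by omega)) rfl
      exact ⟨K', by omega, h3⟩

/-- In the ultradiscrete Toda lattice with particle sizes `Q`, gaps `W` and carrier loads `c`,
the sizes eventually increase to the right and are bounded by the adjacent gaps. -/
theorem toda_eventually_sorted {N : ℕ} {Q W c : ℕ → ℕ → ℕ}
    (hc0 : ∀ t, c t 0 = Q t 0)
    (hc : ∀ t i, c t (i + 1) = c t i - W t i + Q t (i + 1))
    (hQ : ∀ t i, i + 1 < N → Q (t + 1) i = min (c t i) (W t i))
    (hQN : ∀ t i, i + 1 = N → Q (t + 1) i = c t i)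
    (hW : ∀ t i, i + 1 < N → W (t + 1) i + Q (t + 1) i = W t i + Q t (i + 1)) :
    ∃ K, ∀ t ≥ K, ∀ i, i + 1 < N → Q t i ≤ W t i ∧ Q t i ≤ Q t (i + 1) := by
  have hpartial : ∀ t i, i < N →
      ∑ j ∈ Finset.range (i + 1), Q t j = c t i + ∑ j ∈ Finset.range i, Q (t + 1) j := by
    intro t i hi
    induction i with
    | zero => simp [hc0]
    | succ i ih =>
      rw [Finset.sum_range_succ, ih (by omega), Finset.sum_range_succ _ i, hc, hQ t i hi]
      omega
  have htotal : ∀ t, ∑ j ∈ Finset.range N, Q t j = ∑ j ∈ Finset.range N, Q 0 j := by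
    intro t
    induction t with
    | zero => rfl
    | succ t ih =>
      rw [← ih]
      obtain _ | n := N
      · simp
      · rw [hpartial t n (by omega), Finset.sum_range_succ, hQN t n rfl, add_comm]
  have hbound : ∀ i < N, ∀ t, Q t i ≤ ∑ j ∈ Finset.range N, Q 0 j := fun i hi t => by
    rw [← htotal t]
    exact Finset.single_le_sum (f := Q t) (fun _ _ => Nat.zero_le _) (Finset.mem_range.2 hi)
  have hconst : ∀ i < N, ∀ K, (∀ t ≥ K, Q (t + 1) i = c t i) →
      ∃ K' ≥ K, ∀ t ≥ K', Q (t + 1) i = Q t i := by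
    intro i hi K hK
    refine eventually_const_of_bounded _ (hbound i hi) K fun t ht => ?_
    rw [hK t ht]
    cases i with
    | zero => exact (hc0 t).ge
    | succ i =>
      rw [hc]
      exact Nat.le_add_left _ _
  have hfree : ∀ k i, i + k + 1 = N → ∃ K, ∀ t ≥ K, Q (t + 1) i = c t i := by
    intro k
    induction k with
    | zero => exact fun i hi => ⟨0, fun t _ => hQN t i hi⟩
    | succ k ih =>
      intro i hi
      obtain ⟨K, hK⟩ := ih (i + 1) (by omega)
      obtain ⟨K', hK', hK''⟩ := hconst (i + 1) (by omega) K hK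
      refine ⟨K', fun t ht => ?_⟩
      have h1 := hK t (by omega)
      have h2 := hK'' t ht
      have h3 := hc t i
      have h4 := hQ t i (by omega)
      omega
  have hstable : ∀ i < N, ∃ K, ∀ t ≥ K, Q (t + 1) i = c t i ∧ Q (t + 1) i = Q t i := by
    intro i hi
    obtain ⟨K, hK⟩ := hfree (N - 1 - i) i (by omega)
    obtain ⟨K', hK', hK''⟩ := hconst i hi K hK
    exact ⟨K', fun t ht => ⟨hK t (by omega), hK'' t ht⟩⟩
  have hpair : ∀ i, ∃ K, ∀ t ≥ K, i + 1 < N → Q t i ≤ W t i ∧ Q t i ≤ Q t (i + 1) := by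
    intro i
    by_cases hi : i + 1 < N
    swap
    · exact ⟨0, fun t _ h => absurd h hi⟩
    obtain ⟨K₁, h₁⟩ := hstable i (by omega)
    obtain ⟨K₂, h₂⟩ := hstable (i + 1) hi
    refine ⟨max K₁ K₂, fun t ht _ => ⟨?_, ?_⟩⟩
    · have h3 := h₁ t (by omega)
      have h4 := hQ t i hi
      omega
    · by_contra! hlt
      have hdec : ∀ n, Q (t + n) i = Q t i ∧ Q (t + n) (i + 1) = Q t (i + 1) ∧
          W (t + n) i + n ≤ W t i := by
        intro n
        induction n with
        | zero => simp
        | succ n ih =>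
          have h3 := h₁ (t + n) (by omega)
          have h4 := h₂ (t + n) (by omega)
          have h5 := hW (t + n) i hi
          rw [← add_assoc]
          omega
      have := (hdec (W t i + 1)).2.2
      omega
  choose K hK using hpair
  refine ⟨∑ i ∈ Finset.range N, K i, fun t ht i hi => hK i t (le_trans ?_ ht) hi⟩
  exact Finset.single_le_sum (f := K) (fun _ _ => Nat.zero_le _) (Finset.mem_range.2 (by omega))

/-- Iterating the evolution, the runs of a state with finitely many balls eventually are sorted
by length, and each is followed by a gap at least as long. -/
theorem HasRuns.eventually_sorted {N : ℕ} {a₀ d₀ u : ℕ → ℕ} (h : HasRuns N a₀ d₀ u) :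
    ∃ K, ∀ t ≥ K, ∃ a d, HasRuns N a d (_root_.bbsT^[t] u) ∧
      ∀ i, i + 1 < N → d i - a i ≤ a (i + 1) - d i ∧ d i - a i ≤ d (i + 1) - a (i + 1) := by
  let f : (ℕ → ℕ) × (ℕ → ℕ) → (ℕ → ℕ) × (ℕ → ℕ) := fun p => (p.2, runStep N p.1 p.2)
  let r : ℕ → (ℕ → ℕ) × (ℕ → ℕ) := fun t => f^[t] (a₀, d₀)
  have hr : ∀ t, r (t + 1) = f (r t) := fun t => Function.iterate_succ_apply' f t _
  have hruns : ∀ t, HasRuns N (r t).1 (r t).2 (_root_.bbsT^[t] u) := fun t => by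
    induction t with
    | zero => exact h
    | succ t ih =>
      rw [hr, Function.iterate_succ_apply']
      exact ih.bbsT
  obtain ⟨K, hK⟩ := toda_eventually_sorted (N := N)
    (Q := fun t i => (r t).2 i - (r t).1 i) (W := fun t i => (r t).1 (i + 1) - (r t).2 i)
    (c := fun t => runCar (r t).1 (r t).2) (fun _ => rfl) (fun _ _ => rfl)
    (fun t i hi => by simp [hr, f, runStep, hi])
    (fun t i hi => by simp [hr, f, runStep, hi])
    (fun t i hi => by
      have h1 := (hruns t).gap i hi
      have h2 := (hruns t).lt (i + 1) hi
      simp only [hr, f, runStep, hi, if_true]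
      omega)
  exact ⟨K, fun t ht => ⟨_, _, hruns t, hK t ht⟩⟩

/-! ### Soliton contents -/

theorem ncard_conjugate_of_monotone {N : ℕ} {Q : ℕ → ℕ} (hQ : ∀ i, i + 1 < N → Q i ≤ Q (i + 1))
    {j : ℕ} (hj : j < N) :
    {m : ℕ | j + 1 ≤ ∑ i ∈ Finset.range N, if m < Q i then 1 else 0}.ncard = Q (N - 1 - j) := by
  have hmono : ∀ i k, i + k < N → Q i ≤ Q (i + k) := fun i k hk => by
    induction k with
    | zero => exact le_rfl
    | succ k ih => exact (ih (by omega)).trans (hQ (i + k) hk)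
  have hset : {m : ℕ | j + 1 ≤ ∑ i ∈ Finset.range N, if m < Q i then 1 else 0} =
      ↑(Finset.range (Q (N - 1 - j))) := by
    ext m
    simp only [Set.mem_ofPred_eq, Finset.coe_range, Set.mem_Iio, ← Finset.card_filter]
    constructor
    · intro hm
      by_contra! hle
      have hsub : (Finset.range N).filter (fun i => m < Q i) ⊆ Finset.Ico (N - j) N := fun i hi => by
        simp only [Finset.mem_filter, Finset.mem_range] at hi
        simp only [Finset.mem_Ico]
        refine ⟨?_, hi.1⟩
        by_contra! hlt
        have := hmono i (N - 1 - j - i) (by omega)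
        rw [show i + (N - 1 - j - i) = N - 1 - j by omega] at this
        omega
      have := Finset.card_le_card hsub
      rw [Nat.card_Ico] at this
      omega
    · intro hm
      have hsub : Finset.Ico (N - 1 - j) N ⊆ (Finset.range N).filter (fun i => m < Q i) :=
        fun i hi => by
          simp only [Finset.mem_Ico] at hi
          simp only [Finset.mem_filter, Finset.mem_range]
          refine ⟨hi.2, hm.trans_le ?_⟩
          have := hmono (N - 1 - j) (i - (N - 1 - j)) (by omega)
          rwa [show N - 1 - j + (i - (N - 1 - j)) = i by omega] at this
      have := Finset.card_le_card hsub
      rw [Nat.card_Ico] at this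
      omega
  rw [hset, Set.ncard_coe_finset, Finset.card_range]

theorem eq_of_strictAnti_of_range {N : ℕ} {a : Fin N → ℕ} (ha : StrictAnti a) {f : ℕ → ℕ}
    (hf : ∀ i j, i < j → j < N → f i < f j) (hr : Set.range a = {x | ∃ i < N, f i = x})
    (j : Fin N) : a j = f (N - 1 - j) := by
  have hg : StrictAnti fun j : Fin N => f (N - 1 - j) := fun i j hij =>
    hf _ _ (by have := j.2; have : (i : ℕ) < j := hij; omega) (by have := i.2; omega)
  refine congrFun ((ha.range_inj hg).1 ?_) j
  rw [hr]
  ext x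
  constructor
  · rintro ⟨i, hi, rfl⟩
    exact ⟨⟨N - 1 - i, by omega⟩, by simp only; congr 1; omega⟩
  · rintro ⟨i, rfl⟩
    exact ⟨N - 1 - i, by have := i.2; omega, rfl⟩

/-- asymptotic soliton contents: eventually the solitons of
`T^k(u)` are well separated, with lengths given by the conjugate partition `μ`. -/
theorem stmt12 (u : ℕ → ℕ) (N : ℕ) (hu : IsLattice u)
    (ha : ascN u = N) (hd : desN u = N) :
    ∃ K : ℕ, ∀ k ≥ K, ∀ a d : Fin N → ℕ,
      StrictAnti a → StrictAnti d →
      Set.range a = ascSet (bbsT^[k] u) → Set.range d = descSet (bbsT^[k] u) →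
      (∀ j : Fin N, (d j : ℤ) - (a j : ℤ) = muPart u (j : ℕ)) ∧
      (∀ (j : Fin N) (h : (j : ℕ) + 1 < N),
        (a j : ℤ) - (d ⟨(j : ℕ) + 1, h⟩ : ℤ) ≥ (muPart u ((j : ℕ) + 1) : ℤ)) := by
  obtain ⟨M, hM⟩ := hu.1.exists_isBinaryBelow
  have hu0 : u 0 = 0 := hu.1.1
  obtain ⟨N', a₀, d₀, hr₀, -⟩ := exists_hasRuns M u hM hu0
  obtain rfl : N' = N := hr₀.ascN_eq.symm.trans ha
  have hinv : ∀ k, (bbsT^[k] u) 0 = 0 ∧ (∃ M', IsBinaryBelow M' (bbsT^[k] u)) ∧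
      ∀ m, ascN (padElim^[m] (bbsT^[k] u)) = ascN (elim01^[m] u) := fun k => by
    induction k with
    | zero => exact ⟨hu0, ⟨M, hM⟩, fun m => ascN_padElim_iterate_of_isBallot m hM hu.isBallot⟩
    | succ k ih =>
      obtain ⟨h0, ⟨M', hM'⟩, h⟩ := ih
      rw [Function.iterate_succ_apply']
      exact ⟨bbsT_zero _, exists_isBinaryBelow_bbsT hM',
        fun m => (ascN_padElim_iterate_bbsT m hM' h0).trans (h m)⟩
  obtain ⟨K, hK⟩ := hr₀.eventually_sorted
  refine ⟨K, fun k hk a d ha' hd' hra hrd => ?_⟩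
  obtain ⟨A, D, hr, hs⟩ := hK k hk
  obtain ⟨-, ⟨M', hM'⟩, hasc⟩ := hinv k
  have hmu : ∀ j < N', muPart u j = D (N' - 1 - j) - A (N' - 1 - j) := fun j hj => by
    rw [← ncard_conjugate_of_monotone (Q := fun i => D i - A i) (fun i hi => (hs i hi).2) hj, muPart]
    simp only [← hasc, hr.ascN_padElim_iterate _ hM' fun i hi => (hs i hi).1]
  have hA := eq_of_strictAnti_of_range ha' (fun _ _ => hr.left_lt) (hra.trans hr.ascSet_eq)
  have hD := eq_of_strictAnti_of_range hd' (fun _ _ => hr.right_lt) (hrd.trans hr.descSet_eq)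
  refine ⟨fun j => ?_, fun j hj => ?_⟩
  · have := hr.lt (N' - 1 - j) (by have := j.2; omega)
    rw [hA, hD, hmu j j.2]
    omega
  · have h1 := hs (N' - 1 - (j + 1)) (by omega)
    have h2 := hr.gap (N' - 1 - (j + 1)) (by omega)
    rw [show N' - 1 - ((j : ℕ) + 1) + 1 = N' - 1 - j by omega] at h1 h2
    rw [hA, hD, hmu _ hj]
    simp only
    omega
end
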